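/- arXiv:2204.03274 — 5 statements merged into one kernel-verified Lean document; each statement's English description precedes it below -/
import Mathlib

section
/- Fix P > 0 and define the periodised kernel K_P(x) = Σ_{n∈ℤ} K(x + nP) for x ∉ Pℤ (the series converges absolutely for such x). Then K_P is P-periodic, even, positive, strictly decreasing on (0, P/2), convex on (0, P), infinitely differentiable on ℝ ∖ Pℤ, completely monotone on (0, P/2) (i.e. (−1)^j · K_P^{(j)}(x) > 0 for all j ∈ ℕ and x ∈ (0, P/2)), and there exists a function K_{P,reg} infinitely differentiable on (−P, P) such that K_P(x) = 1/√(2π|x|) + K_{P,reg}(x) for x ∈ (−P, P) ∖ {0}. -/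
open Real Filter MeasureTheory

/-- The Whitham symbol `m(ξ) = √(tanh ξ / ξ)`, with `m 0 = 1`. -/
noncomputable def whithamSymbol (ξ : ℝ) : ℝ :=
  if ξ = 0 then 1 else Real.sqrt (Real.tanh ξ / ξ)

/-- The Whitham kernel, defined for `x ≠ 0` as the improper integral
`K(x) = (1/π)·lim_{R→∞} ∫₀^R m(ξ) cos(xξ) dξ`, and `K 0 = 0`. -/
noncomputable def whithamKernel (x : ℝ) : ℝ :=
  if x = 0 then 0 else
    limUnder atTop
      (fun R : ℝ => (1 / Real.pi) * ∫ ξ in (0:ℝ)..R, whithamSymbol ξ * Real.cos (x * ξ))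

/-- The periodised Whitham kernel `K_P(x) = Σ_{n ∈ ℤ} K(x + nP)`. -/
noncomputable def periodisedKernel (P x : ℝ) : ℝ :=
  ∑' n : ℤ, whithamKernel (x + n * P)

/-- `x` belongs to the lattice `Pℤ`. -/
def inLattice (P x : ℝ) : Prop := ∃ n : ℤ, x = n * P

open scoped Topology

lemma norm_mul_cexp_I (F : ℂ → ℂ) (x a y : ℝ) :
    ‖F (a + y * Complex.I) * Complex.exp (Complex.I * x * (a + y * Complex.I))‖
      = ‖F (a + y * Complex.I)‖ * rexp (-x * y) := by
  rw [norm_mul, Complex.norm_exp]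
  simp

lemma integrableOn_vertical {F : ℂ → ℂ} {x a : ℝ} {b : ℝ → ℝ}
    (ha : 0 < a) (hd : DifferentiableOn ℂ F {z | 0 < z.re})
    (hb : ∀ᵐ y : ℝ ∂(volume.restrict (Set.Ioi (0 : ℝ))), ‖F (a + y * Complex.I)‖ ≤ b y)
    (hbi : IntegrableOn (fun y => b y * rexp (-x * y)) (Set.Ioi 0)) :
    IntegrableOn (fun y : ℝ => F (a + y * Complex.I) *
      Complex.exp (Complex.I * x * (a + y * Complex.I))) (Set.Ioi 0) := by
  refine Integrable.mono' hbi ?_ ?_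
  · refine Continuous.aestronglyMeasurable ?_
    refine Continuous.mul ?_ (by fun_prop)
    refine hd.continuousOn.comp_continuous (by fun_prop) ?_
    intro y
    simpa using ha
  · filter_upwards [hb] with y hy
    rw [norm_mul_cexp_I]
    gcongr

lemma contour_half_strip {F : ℂ → ℂ} {x ε R D : ℝ} {T : ℕ → ℝ} (hx : 0 < x)
    (hε : 0 < ε) (hεR : ε ≤ R)
    (hd : DifferentiableOn ℂ F {z | 0 < z.re})
    (hT : Tendsto T atTop atTop)
    (htop : ∀ n, ∀ ξ ∈ Set.Icc ε R, ‖F (ξ + T n * Complex.I)‖ ≤ D)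
    (h1 : IntegrableOn (fun y : ℝ => F (ε + y * Complex.I) *
      Complex.exp (Complex.I * x * (ε + y * Complex.I))) (Set.Ioi 0))
    (h2 : IntegrableOn (fun y : ℝ => F (R + y * Complex.I) *
      Complex.exp (Complex.I * x * (R + y * Complex.I))) (Set.Ioi 0)) :
    (∫ ξ in ε..R, F ξ * Complex.exp (Complex.I * x * ξ)) =
      Complex.I * (∫ y in Set.Ioi (0 : ℝ), F (ε + y * Complex.I) *
        Complex.exp (Complex.I * x * (ε + y * Complex.I))) -
      Complex.I * (∫ y in Set.Ioi (0 : ℝ), F (R + y * Complex.I) *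
        Complex.exp (Complex.I * x * (R + y * Complex.I))) := by
  set G : ℂ → ℂ := fun z => F z * Complex.exp (Complex.I * x * z) with hG
  have hGd : DifferentiableOn ℂ G {z | 0 < z.re} := by
    refine hd.mul ?_
    fun_prop
  have hrect : ∀ n, (∫ ξ in ε..R, G ξ) = (∫ ξ in ε..R, G (ξ + T n * Complex.I)) -
      Complex.I * (∫ y in (0 : ℝ)..T n, G (R + y * Complex.I)) +
      Complex.I * (∫ y in (0 : ℝ)..T n, G (ε + y * Complex.I)) := by
    intro n
    have := Complex.integral_boundary_rect_eq_zero_of_differentiableOn G ε (R + T n * Complex.I)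
      (hGd.mono ?_)
    · simp at this
      linear_combination this
    · intro z hz
      have := hz.1
      simp [Set.uIcc_of_le hεR] at this
      exact hε.trans_le this.1
  have l1 := intervalIntegral_tendsto_integral_Ioi 0 h1 hT
  have l2 := intervalIntegral_tendsto_integral_Ioi 0 h2 hT
  have l0 : Tendsto (fun n => ∫ ξ in ε..R, G (ξ + T n * Complex.I)) atTop (𝓝 0) := by
    have e : Tendsto (fun n => D * rexp (-x * T n) * |R - ε|) atTop (𝓝 0) := by
      have : Tendsto (fun n => rexp (-x * T n)) atTop (𝓝 0) :=
        Real.tendsto_exp_atBot.comp (hT.const_mul_atTop_of_neg (by linarith))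
      simpa using (this.const_mul D).mul_const |R - ε|
    refine squeeze_zero_norm (fun n => ?_) e
    refine intervalIntegral.norm_integral_le_of_norm_le_const (fun ξ hξ => ?_)
    rw [Set.uIoc_of_le hεR] at hξ
    simp only [hG]
    rw [norm_mul_cexp_I]
    gcongr
    exact htop n ξ ⟨hξ.1.le, hξ.2⟩
  have l := (l0.sub (l2.const_mul Complex.I)).add (l1.const_mul Complex.I)
  have := tendsto_nhds_unique (tendsto_const_nhds.congr hrect) l
  simp only [hG] at this
  rw [this]
  ring

/-- Rotation of an oscillatory integral over the positive half-line to the imaginary axis. -/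
lemma tendsto_integral_mul_cexp {F : ℂ → ℂ} {F₀ : ℝ → ℂ} {g : ℝ → ℝ} {x C D : ℝ} {T : ℕ → ℝ}
    (hx : 0 < x) (hd : DifferentiableOn ℂ F {z | 0 < z.re})
    (hbig : ∀ z : ℂ, 1 ≤ z.re → ‖F z‖ ≤ C / √z.re)
    (hsmall : ∀ᵐ y : ℝ ∂(volume.restrict (Set.Ioi (0 : ℝ))), ∀ ε ∈ Set.Ioc (0 : ℝ) 1,
      ‖F (ε + y * Complex.I)‖ ≤ g y)
    (hgi : IntegrableOn (fun y => g y * rexp (-x * y)) (Set.Ioi 0))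
    (hT : Tendsto T atTop atTop)
    (htop : ∀ n, ∀ ε ∈ Set.Ioc (0 : ℝ) 1, ‖F (ε + T n * Complex.I)‖ ≤ D)
    (hF₀ : ∀ᵐ y : ℝ ∂(volume.restrict (Set.Ioi (0 : ℝ))),
      Tendsto (fun ε : ℝ => F (ε + y * Complex.I)) (𝓝[>] 0) (𝓝 (F₀ y)))
    (hfint : ∀ R : ℝ, 0 < R → IntervalIntegrable (fun ξ : ℝ => F ξ) volume 0 R) :
    Tendsto (fun R : ℝ => ∫ ξ in (0 : ℝ)..R, F ξ * Complex.exp (Complex.I * x * ξ)) atTop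
      (𝓝 (Complex.I * ∫ y in Set.Ioi (0 : ℝ), F₀ y * rexp (-x * y))) := by
  have hexp : IntegrableOn (fun y => rexp (-x * y)) (Set.Ioi 0) :=
    integrableOn_exp_mul_Ioi (by linarith) 0
  have hC : 0 ≤ C := by
    have := (norm_nonneg _).trans (hbig 1 (by simp))
    simpa using this
  have hR : ∀ R : ℝ, 1 ≤ R → IntegrableOn (fun y : ℝ => F (R + y * Complex.I) *
      Complex.exp (Complex.I * x * (R + y * Complex.I))) (Set.Ioi 0) := by
    intro R h
    refine integrableOn_vertical (b := fun _ => C / √R) (by linarith) hd ?_ (hexp.const_mul _)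
    refine ae_of_all _ fun y => ?_
    simpa using hbig (R + y * Complex.I) (by simpa using h)
  have hεi : ∀ ε ∈ Set.Ioc (0 : ℝ) 1, IntegrableOn (fun y : ℝ => F (ε + y * Complex.I) *
      Complex.exp (Complex.I * x * (ε + y * Complex.I))) (Set.Ioi 0) := by
    intro ε h
    refine integrableOn_vertical h.1 hd ?_ hgi
    filter_upwards [hsmall] with y hy using hy ε h
  have key : ∀ R : ℝ, 1 ≤ R → (∫ ξ in (0 : ℝ)..R, F ξ * Complex.exp (Complex.I * x * ξ)) =
      Complex.I * (∫ y in Set.Ioi (0 : ℝ), F₀ y * rexp (-x * y)) -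
      Complex.I * (∫ y in Set.Ioi (0 : ℝ), F (R + y * Complex.I) *
        Complex.exp (Complex.I * x * (R + y * Complex.I))) := by
    intro R h
    have hev : ∀ᶠ ε : ℝ in 𝓝[>] 0, ε ∈ Set.Ioc (0 : ℝ) 1 :=
      Ioc_mem_nhdsGT (by norm_num)
    have hGint : IntervalIntegrable (fun ξ : ℝ => F ξ * Complex.exp (Complex.I * x * ξ))
        volume 0 R := (hfint R (by linarith)).mul_continuousOn (by fun_prop)
    have a1 : Tendsto (fun ε : ℝ => ∫ ξ in ε..R, F ξ * Complex.exp (Complex.I * x * ξ))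
        (𝓝[>] 0) (𝓝 (∫ ξ in (0 : ℝ)..R, F ξ * Complex.exp (Complex.I * x * ξ))) := by
      have := intervalIntegral.continuousOn_primitive_interval_left
        (f := fun ξ : ℝ => F ξ * Complex.exp (Complex.I * x * ξ)) (a := 0) (b := R) (μ := volume)
        ((intervalIntegrable_iff' (by finiteness)).1 hGint)
      have := this 0 (by simp)
      refine this.mono_left (nhdsWithin_le_of_mem ?_)
      rw [Set.uIcc_of_le (by linarith)]
      exact mem_of_superset (Ioc_mem_nhdsGT (show (0:ℝ) < R by linarith)) Set.Ioc_subset_Icc_self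
    have a2 : Tendsto (fun ε : ℝ => ∫ y in Set.Ioi (0 : ℝ), F (ε + y * Complex.I) *
        Complex.exp (Complex.I * x * (ε + y * Complex.I))) (𝓝[>] 0)
        (𝓝 (∫ y in Set.Ioi (0 : ℝ), F₀ y * rexp (-x * y))) := by
      refine tendsto_integral_filter_of_dominated_convergence
        (fun y => g y * rexp (-x * y)) ?_ ?_ hgi ?_
      · filter_upwards [hev] with ε h using (hεi ε h).aestronglyMeasurable
      · filter_upwards [hev] with ε h
        filter_upwards [hsmall] with y hy
        rw [norm_mul_cexp_I]
        gcongr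
        exact hy ε h
      · filter_upwards [hF₀] with y hy
        refine hy.mul ?_
        have c : Continuous fun ε : ℝ =>
          Complex.exp (Complex.I * x * (ε + y * Complex.I)) := by fun_prop
        have := (c.tendsto 0).mono_left (nhdsWithin_le_nhds (s := Set.Ioi 0))
        convert this using 2
        push_cast
        congr 1
        linear_combination (-x * y : ℂ) * Complex.I_sq
    have e : ∀ᶠ ε : ℝ in 𝓝[>] 0, (∫ ξ in ε..R, F ξ * Complex.exp (Complex.I * x * ξ)) =
      Complex.I * (∫ y in Set.Ioi (0 : ℝ), F (ε + y * Complex.I) *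
        Complex.exp (Complex.I * x * (ε + y * Complex.I))) -
      Complex.I * (∫ y in Set.Ioi (0 : ℝ), F (R + y * Complex.I) *
        Complex.exp (Complex.I * x * (R + y * Complex.I))) := by
      filter_upwards [hev] with ε hε
      refine contour_half_strip (D := max C D) hx hε.1 (hε.2.trans h) hd hT ?_ (hεi ε hε) (hR R h)
      intro n ξ hξ
      rcases le_total ξ 1 with h1 | h1
      · exact (htop n ξ ⟨hε.1.trans_le hξ.1, h1⟩).trans (le_max_right _ _)
      · refine (hbig _ (by simpa using h1)).trans (le_trans ?_ (le_max_left _ _))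
        refine div_le_self hC ?_
        simpa [Real.one_le_sqrt] using h1
    exact tendsto_nhds_unique (a1.congr' e) ((a2.const_mul _).sub_const _)
  have l : Tendsto (fun R : ℝ => Complex.I * (∫ y in Set.Ioi (0 : ℝ), F (R + y * Complex.I) *
        Complex.exp (Complex.I * x * (R + y * Complex.I)))) atTop (𝓝 0) := by
    have e : Tendsto (fun R : ℝ => C / √R * ∫ y in Set.Ioi (0 : ℝ), rexp (-x * y)) atTop
        (𝓝 0) := by
      have : Tendsto (fun R : ℝ => C / √R) atTop (𝓝 0) :=
        Real.tendsto_sqrt_atTop.const_div_atTop C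
      simpa using this.mul_const (∫ y in Set.Ioi (0 : ℝ), rexp (-x * y))
    refine squeeze_zero_norm' ?_ e
    filter_upwards [eventually_ge_atTop 1] with R h
    rw [norm_mul, Complex.norm_I, one_mul, ← integral_const_mul]
    refine norm_integral_le_of_norm_le (hexp.const_mul _) (ae_of_all _ fun y => ?_)
    rw [norm_mul_cexp_I]
    gcongr
    simpa using hbig (R + y * Complex.I) (by simpa using h)
  have := (tendsto_const_nhds (x := Complex.I * ∫ y in Set.Ioi (0 : ℝ), F₀ y * rexp (-x * y))).sub l
  rw [sub_zero] at this
  refine this.congr' ?_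
  filter_upwards [eventually_ge_atTop 1] with R h using (key R h).symm

lemma tendsto_integral_mul_cos {F : ℂ → ℂ} {F₀ : ℝ → ℂ} {f g : ℝ → ℝ} {x C D : ℝ} {T : ℕ → ℝ}
    (hx : 0 < x) (hd : DifferentiableOn ℂ F {z | 0 < z.re})
    (hbig : ∀ z : ℂ, 1 ≤ z.re → ‖F z‖ ≤ C / √z.re)
    (hsmall : ∀ᵐ y : ℝ ∂(volume.restrict (Set.Ioi (0 : ℝ))), ∀ ε ∈ Set.Ioc (0 : ℝ) 1,
      ‖F (ε + y * Complex.I)‖ ≤ g y)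
    (hgi : IntegrableOn (fun y => g y * rexp (-x * y)) (Set.Ioi 0))
    (hT : Tendsto T atTop atTop)
    (htop : ∀ n, ∀ ε ∈ Set.Ioc (0 : ℝ) 1, ‖F (ε + T n * Complex.I)‖ ≤ D)
    (hF₀ : ∀ᵐ y : ℝ ∂(volume.restrict (Set.Ioi (0 : ℝ))),
      Tendsto (fun ε : ℝ => F (ε + y * Complex.I)) (𝓝[>] 0) (𝓝 (F₀ y)))
    (hF₀m : Measurable F₀)
    (hf : ∀ ξ : ℝ, 0 < ξ → F ξ = f ξ)
    (hfint : ∀ R : ℝ, 0 < R → IntervalIntegrable f volume 0 R) :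
    IntegrableOn (fun y => -(F₀ y).im * rexp (-x * y)) (Set.Ioi 0) ∧
    Tendsto (fun R : ℝ => ∫ ξ in (0 : ℝ)..R, f ξ * Real.cos (x * ξ)) atTop
      (𝓝 (∫ y in Set.Ioi (0 : ℝ), -(F₀ y).im * rexp (-x * y))) := by
  have hfint' : ∀ R : ℝ, 0 < R → IntervalIntegrable (fun ξ : ℝ => F ξ) volume 0 R := by
    intro R hR
    have h := hfint R hR
    rw [intervalIntegrable_iff_integrableOn_Ioc_of_le hR.le] at h ⊢
    refine IntegrableOn.congr_fun (f := fun ξ : ℝ => (f ξ : ℂ)) (Integrable.ofReal h) ?_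
      measurableSet_Ioc
    intro ξ hξ
    exact (hf ξ hξ.1).symm
  have h := tendsto_integral_mul_cexp hx hd hbig hsmall hgi hT htop hF₀ hfint'
  have hF₀i : IntegrableOn (fun y : ℝ => F₀ y * rexp (-x * y)) (Set.Ioi 0) := by
    refine Integrable.mono' hgi (by fun_prop) ?_
    filter_upwards [hsmall, hF₀] with y h1 h2
    rw [norm_mul, Complex.norm_real, Real.norm_of_nonneg (exp_pos _).le]
    gcongr
    refine le_of_tendsto h2.norm ?_
    filter_upwards [Ioc_mem_nhdsGT (show (0 : ℝ) < 1 by norm_num)] with ε hε using h1 ε hε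
  have him : ∀ y : ℝ, -(F₀ y).im * rexp (-x * y) = (Complex.I * (F₀ y * rexp (-x * y))).re := by
    intro y
    rw [Complex.I_mul_re, Complex.im_mul_ofReal, neg_mul]
  simp_rw [him]
  have hIi : Integrable (fun y : ℝ => Complex.I * (F₀ y * rexp (-x * y)))
    (volume.restrict (Set.Ioi 0)) := hF₀i.const_mul _
  refine ⟨hIi.re, ?_⟩
  have e1 : ∫ y in Set.Ioi (0 : ℝ), (Complex.I * (F₀ y * rexp (-x * y))).re =
      (Complex.I * ∫ y in Set.Ioi (0 : ℝ), F₀ y * rexp (-x * y)).re := by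
    rw [← integral_const_mul]
    exact integral_re hIi
  rw [e1]
  refine ((Complex.continuous_re.tendsto _).comp h).congr' ?_
  filter_upwards [eventually_gt_atTop 0] with R hR
  have hGi : IntervalIntegrable (fun ξ : ℝ => F ξ * Complex.exp (Complex.I * x * ξ))
    volume 0 R := (hfint' R hR).mul_continuousOn (by fun_prop)
  simp only [Function.comp]
  rw [intervalIntegral.integral_of_le hR.le, intervalIntegral.integral_of_le hR.le]
  rw [intervalIntegrable_iff_integrableOn_Ioc_of_le hR.le] at hGi
  refine (integral_re hGi).symm.trans ?_
  refine setIntegral_congr_fun measurableSet_Ioc fun ξ hξ => ?_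
  simp only [hf ξ hξ.1]
  rw [show Complex.I * x * ξ = ((x * ξ : ℝ) : ℂ) * Complex.I by push_cast; ring]
  rw [← Complex.exp_ofReal_mul_I_re (x * ξ)]
  exact Complex.re_ofReal_mul _ _

/-- The Fresnel integral `∫₀^∞ ξ^(-1/2) cos (x ξ) dξ = √(π / (2 x))`. -/
lemma tendsto_integral_rpow_mul_cos {x : ℝ} (hx : 0 < x) :
    Tendsto (fun R : ℝ => ∫ ξ in (0 : ℝ)..R, ξ ^ (-1 / 2 : ℝ) * Real.cos (x * ξ)) atTop
      (𝓝 (√(π / (2 * x)))) := by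
  have hn : ∀ z : ℂ, z ≠ 0 → ‖z ^ (-1 / 2 : ℂ)‖ = 1 / √‖z‖ := by
    intro z hz
    rw [show (-1 / 2 : ℂ) = ((-1 / 2 : ℝ) : ℂ) by push_cast; rfl,
      Complex.norm_cpow_real, show (-1 / 2 : ℝ) = -(1 / 2) by ring,
      Real.rpow_neg (norm_nonneg _), Real.sqrt_eq_rpow]
    exact (one_div _).symm
  have hle : ∀ (z : ℂ) (r : ℝ), 0 < r → r ≤ ‖z‖ → ‖z ^ (-1 / 2 : ℂ)‖ ≤ 1 / √r := by
    intro z r hr h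
    rw [hn z (norm_pos_iff.1 (hr.trans_le h))]
    gcongr
  have him : ∀ ε y : ℝ, 0 < y → y ≤ ‖(ε + y * Complex.I : ℂ)‖ := by
    intro ε y hy
    have := Complex.abs_im_le_norm (ε + y * Complex.I : ℂ)
    simpa [abs_of_pos hy] using this
  have hpow : ∀ y : ℝ, 0 < y → y ^ (-1 / 2 : ℝ) = 1 / √y := by
    intro y hy
    rw [show (-1 / 2 : ℝ) = -(1 / 2) by ring,
      Real.rpow_neg hy.le, Real.sqrt_eq_rpow]
    exact (one_div _).symm
  have hG : IntegrableOn (fun y : ℝ => y ^ (-1 / 2 : ℝ) * rexp (-x * y)) (Set.Ioi 0) := by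
    have := integrableOn_rpow_mul_exp_neg_mul_rpow (s := -1 / 2) (p := 1) (b := x)
      (by norm_num) one_pos hx
    simpa using this
  have key := (tendsto_integral_mul_cos (F := fun z => z ^ (-1 / 2 : ℂ))
    (F₀ := fun y : ℝ => (y * Complex.I) ^ (-1 / 2 : ℂ)) (f := fun ξ => ξ ^ (-1 / 2 : ℝ))
    (g := fun y => y ^ (-1 / 2 : ℝ)) (C := 1) (D := 1)
    (T := fun n => (n : ℝ) + 1) hx ?_ ?_ ?_ hG ?_ ?_ ?_ ?_ ?_ ?_).2
  · convert key using 2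
    have e : ∀ y ∈ Set.Ioi (0 : ℝ), -(((y : ℂ) * Complex.I) ^ (-1 / 2 : ℂ)).im * rexp (-x * y)
        = (√2 / 2) * (y ^ ((1 / 2 : ℝ) - 1) * rexp (-(x * y))) := by
      intro y hy
      have hy : 0 < y := hy
      have : ((y : ℂ) * Complex.I) ^ (-1 / 2 : ℂ) =
          ((y ^ (-1 / 2 : ℝ) : ℝ) : ℂ) * Complex.exp ((-(π / 4) : ℝ) * Complex.I) := by
        rw [Complex.cpow_def_of_ne_zero (by simp [hy.ne']), Complex.log_ofReal_mul hy (by simp),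
          Complex.log_I, Real.rpow_def_of_pos hy, Complex.ofReal_exp, ← Complex.exp_add]
        push_cast
        ring_nf
      rw [this, Complex.im_ofReal_mul, Complex.exp_ofReal_mul_I_im, Real.sin_neg,
        Real.sin_pi_div_four, show (1 / 2 : ℝ) - 1 = -1 / 2 by norm_num, neg_mul]
      ring_nf
    rw [setIntegral_congr_fun measurableSet_Ioi e, integral_const_mul,
      Real.integral_rpow_mul_exp_neg_mul_Ioi (by norm_num) hx, Real.Gamma_one_half_eq,
      ← Real.sqrt_eq_rpow, Real.sqrt_div pi_pos.le, Real.sqrt_mul (by norm_num), Real.sqrt_div]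
    · have := Real.sq_sqrt (show (0 : ℝ) ≤ 2 by norm_num)
      field_simp
      simp
    · norm_num
  · intro z hz
    refine DifferentiableAt.differentiableWithinAt ?_
    exact differentiableAt_id.cpow_const (Or.inl hz)
  · intro z hz
    exact hle z _ (by linarith) (Complex.re_le_norm z)
  · filter_upwards [ae_restrict_mem measurableSet_Ioi] with y hy ε hε
    rw [hpow y hy]
    exact hle _ _ hy (him _ _ hy)
  · exact tendsto_natCast_atTop_atTop.atTop_add tendsto_const_nhds
  · intro n ε hε
    have h1 := him ε (n + 1) (by positivity)
    have := hle (ε + ((n + 1 : ℝ) : ℂ) * Complex.I) 1 one_pos (le_trans (by simp) h1)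
    simpa using this
  · filter_upwards [ae_restrict_mem measurableSet_Ioi] with y hy
    have hc : ContinuousAt (fun ε : ℝ => ((ε : ℂ) + y * Complex.I) ^ (-1 / 2 : ℂ)) 0 := by
      refine ContinuousAt.cpow (by fun_prop) continuousAt_const (Or.inr ?_)
      simpa using (ne_of_gt hy)
    have := hc.tendsto.mono_left (nhdsWithin_le_nhds (s := Set.Ioi 0))
    simpa using this
  · fun_prop
  · intro ξ hξ
    rw [Complex.ofReal_cpow hξ.le]
    push_cast
    rfl
  · intro R _
    exact intervalIntegral.intervalIntegrable_rpow' (by norm_num)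

lemma sinh_add_mul_I (a b : ℝ) : Complex.sinh (a + b * Complex.I) =
    Real.sinh a * Real.cos b + Real.cosh a * Real.sin b * Complex.I := by
  rw [Complex.sinh_add, Complex.cosh_mul_I, Complex.sinh_mul_I]
  push_cast
  ring

lemma cosh_add_mul_I (a b : ℝ) : Complex.cosh (a + b * Complex.I) =
    Real.cosh a * Real.cos b + Real.sinh a * Real.sin b * Complex.I := by
  rw [Complex.cosh_add, Complex.cosh_mul_I, Complex.sinh_mul_I]
  push_cast
  ring

lemma norm_sq_sinh (a b : ℝ) :
    ‖Complex.sinh (a + b * Complex.I)‖ ^ 2 = Real.sinh a ^ 2 + Real.sin b ^ 2 := by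
  have h : Complex.sinh (a + b * Complex.I) = ((Real.sinh a * Real.cos b : ℝ) : ℂ) +
      ((Real.cosh a * Real.sin b : ℝ) : ℂ) * Complex.I := by
    rw [sinh_add_mul_I]; push_cast; rfl
  rw [Complex.sq_norm, h, Complex.normSq_add_mul_I]
  linear_combination Real.sin b ^ 2 * Real.cosh_sq a + Real.sinh a ^ 2 * Real.sin_sq_add_cos_sq b

lemma norm_sq_cosh (a b : ℝ) :
    ‖Complex.cosh (a + b * Complex.I)‖ ^ 2 = Real.sinh a ^ 2 + Real.cos b ^ 2 := by
  have h : Complex.cosh (a + b * Complex.I) = ((Real.cosh a * Real.cos b : ℝ) : ℂ) +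
      ((Real.sinh a * Real.sin b : ℝ) : ℂ) * Complex.I := by
    rw [cosh_add_mul_I]; push_cast; rfl
  rw [Complex.sq_norm, h, Complex.normSq_add_mul_I]
  linear_combination Real.cos b ^ 2 * Real.cosh_sq a + Real.sinh a ^ 2 * Real.sin_sq_add_cos_sq b

lemma norm_sq_add_mul_I (a b : ℝ) : ‖(a + b * Complex.I : ℂ)‖ ^ 2 = a ^ 2 + b ^ 2 := by
  rw [Complex.sq_norm, Complex.normSq_apply]
  simp
  ring

lemma cosh_ne_zero_of_re_pos {z : ℂ} (hz : 0 < z.re) : Complex.cosh z ≠ 0 := by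
  rw [← Complex.re_add_im z, ← norm_pos_iff]
  have h := norm_sq_cosh z.re z.im
  have : 0 < Real.sinh z.re := Real.sinh_pos_iff.2 hz
  refine lt_of_le_of_ne (norm_nonneg _) fun h0 => ?_
  rw [← h0] at h
  nlinarith [sq_nonneg (Real.cos z.im)]

lemma ne_zero_of_re_pos {z : ℂ} (hz : 0 < z.re) : z ≠ 0 := by
  rintro rfl
  simp at hz

/-- Real and imaginary parts of `tanh z / z`. -/
lemma tanh_div_self_eq (a b : ℝ) (ha : 0 < a) :
    Complex.tanh (a + b * Complex.I) / (a + b * Complex.I) =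
      (((a * Real.sinh a * Real.cosh a + b * Real.sin b * Real.cos b) /
        ((Real.sinh a ^ 2 + Real.cos b ^ 2) * (a ^ 2 + b ^ 2)) : ℝ) : ℂ) +
      (((a * Real.sin b * Real.cos b - b * Real.sinh a * Real.cosh a) /
        ((Real.sinh a ^ 2 + Real.cos b ^ 2) * (a ^ 2 + b ^ 2)) : ℝ) : ℂ) * Complex.I := by
  have hz : 0 < (a + b * Complex.I : ℂ).re := by simpa
  have hC := cosh_ne_zero_of_re_pos hz
  have hz0 := ne_zero_of_re_pos hz
  have hs : 0 < Real.sinh a := Real.sinh_pos_iff.2 ha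
  have hD : ((Real.sinh a ^ 2 + Real.cos b ^ 2 : ℝ) : ℂ) ≠ 0 := by
    exact_mod_cast ne_of_gt (by positivity)
  have hE : ((a ^ 2 + b ^ 2 : ℝ) : ℂ) ≠ 0 := by
    exact_mod_cast ne_of_gt (by positivity)
  have h1 : (Real.cosh a : ℂ) ^ 2 = Real.sinh a ^ 2 + 1 := by exact_mod_cast Real.cosh_sq a
  have h2 : (Real.sin b : ℂ) ^ 2 + Real.cos b ^ 2 = 1 := by
    exact_mod_cast Real.sin_sq_add_cos_sq b
  have h3 := Complex.I_sq
  rw [Complex.tanh_eq_sinh_div_cosh]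
  rw [cosh_add_mul_I] at *
  rw [sinh_add_mul_I]
  push_cast at *
  generalize (Complex.sinh (a : ℂ)) = sa at *
  generalize (Complex.cosh (a : ℂ)) = ca at *
  generalize (Complex.sin (b : ℂ)) = sb at *
  generalize (Complex.cos (b : ℂ)) = cb at *
  generalize Complex.I = i at *
  have k1 : (sa * cb + ca * sb * i) * (ca * cb - sa * sb * i) = sa * ca + sb * cb * i := by
    linear_combination (-ca * sb ^ 2 * sa) * h3 + sa * ca * h2 + (sb * cb * i) * h1
  have k2 : (ca * cb + sa * sb * i) * (ca * cb - sa * sb * i) = sa ^ 2 + cb ^ 2 := by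
    linear_combination (-sa ^ 2 * sb ^ 2) * h3 + sa ^ 2 * h2 + cb ^ 2 * h1
  have k3 : ((a : ℂ) + b * i) * (a - b * i) = a ^ 2 + b ^ 2 := by
    linear_combination (-(b : ℂ) ^ 2) * h3
  have e : (sa * cb + ca * sb * i) / (ca * cb + sa * sb * i) =
      (sa * ca + sb * cb * i) / (sa ^ 2 + cb ^ 2) := by
    rw [div_eq_div_iff hC hD, ← k1, ← k2]
    ring
  have e' : (a + b * i : ℂ)⁻¹ = (a - b * i) / (a ^ 2 + b ^ 2) := by
    rw [← k3, div_mul_cancel_right₀]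
    rintro h
    rw [h, mul_zero] at k3
    exact hE k3.symm
  rw [div_eq_mul_inv, e, e']
  field_simp
  linear_combination (-sb * cb * b) * h3

lemma tanh_div_self_im_neg {z : ℂ} (hz : 0 < z.re) (hi : 0 < z.im) :
    (Complex.tanh z / z).im < 0 := by
  have h := tanh_div_self_eq z.re z.im hz
  rw [Complex.re_add_im] at h
  rw [h]
  have hs : z.re < Real.sinh z.re := Real.self_lt_sinh_iff.2 hz
  have hc : 1 ≤ Real.cosh z.re := Real.one_le_cosh _
  have hsin : Real.sin z.im * Real.cos z.im < z.im := by
    have := Real.sin_lt (show 0 < 2 * z.im by linarith)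
    rw [Real.sin_two_mul] at this
    linarith
  simp only [Complex.add_im, Complex.ofReal_im, Complex.im_ofReal_mul, Complex.I_im, mul_one,
    zero_add]
  refine div_neg_of_neg_of_pos ?_ (by positivity)
  have h1 : z.re * (Real.sin z.im * Real.cos z.im) < z.re * z.im := by gcongr
  have h2 : z.re ≤ Real.sinh z.re * Real.cosh z.re := by nlinarith
  nlinarith

lemma tanh_div_self_mem_slitPlane {z : ℂ} (hz : 0 < z.re) :
    Complex.tanh z / z ∈ Complex.slitPlane := by
  rw [Complex.mem_slitPlane_iff]
  rcases lt_trichotomy z.im 0 with h | h | h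
  · right
    have := tanh_div_self_im_neg (z := starRingEnd ℂ z) (by simpa) (by simpa)
    rw [Complex.tanh_conj, ← map_div₀, Complex.conj_im] at this
    linarith
  · left
    have h' := tanh_div_self_eq z.re z.im hz
    rw [Complex.re_add_im, h] at h'
    rw [h']
    have : 0 < Real.sinh z.re := Real.sinh_pos_iff.2 hz
    have : 0 < Real.cosh z.re := Real.cosh_pos _
    rw [Complex.add_re, Complex.ofReal_re, Complex.re_ofReal_mul, Complex.I_re]
    simp only [mul_zero, add_zero, zero_mul]
    positivity
  · exact Or.inr (tanh_div_self_im_neg hz h).ne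

/-- The holomorphic extension `√(tanh z / z)` of the Whitham symbol to the right half-plane. -/
noncomputable def whithamExt (z : ℂ) : ℂ := (Complex.tanh z / z) ^ (1 / 2 : ℂ)

lemma differentiableOn_whithamExt : DifferentiableOn ℂ whithamExt {z | 0 < z.re} := by
  intro z hz
  have hz : 0 < z.re := hz
  refine DifferentiableAt.differentiableWithinAt ?_
  refine DifferentiableAt.cpow_const ?_ (tanh_div_self_mem_slitPlane hz)
  simp only [Complex.tanh_eq_sinh_div_cosh]
  refine (DifferentiableAt.div (by fun_prop) (by fun_prop) (cosh_ne_zero_of_re_pos hz)).div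
    (by fun_prop) (ne_zero_of_re_pos hz)

lemma norm_whithamExt (z : ℂ) :
    ‖whithamExt z‖ = √(‖Complex.sinh z‖ / ‖Complex.cosh z‖ / ‖z‖) := by
  rw [whithamExt, show (1 / 2 : ℂ) = ((1 / 2 : ℝ) : ℂ) by push_cast; rfl,
    Complex.norm_cpow_real, ← Real.sqrt_eq_rpow, Complex.tanh_eq_sinh_div_cosh, norm_div, norm_div]

lemma norm_whithamExt_le {z : ℂ} (hz : 1 ≤ z.re) : ‖whithamExt z‖ ≤ √2 / √z.re := by
  rw [norm_whithamExt, ← Real.sqrt_div (by norm_num)]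
  have hc := norm_pos_iff.2 (cosh_ne_zero_of_re_pos (show 0 < z.re by linarith))
  refine Real.sqrt_le_sqrt ?_
  refine div_le_div₀ (by norm_num) ?_ (by linarith) (Complex.re_le_norm z)
  rw [div_le_iff₀ hc]
  refine abs_le_of_sq_le_sq' ?_ (by positivity) |>.2
  have h1 := norm_sq_sinh z.re z.im
  have h2 := norm_sq_cosh z.re z.im
  rw [Complex.re_add_im] at h1 h2
  have : 1 ≤ Real.sinh z.re := hz.trans (Real.self_le_sinh_iff.2 (by linarith))
  rw [mul_pow, h1, h2]
  nlinarith [Real.sin_sq_le_one z.im, sq_nonneg (Real.cos z.im)]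

lemma norm_whithamExt_le' {a b : ℝ} (ha : a ∈ Set.Ioc (0 : ℝ) 1) (hb : Real.cos b ≠ 0) :
    ‖whithamExt (a + b * Complex.I)‖ ≤ √(rexp 1 * (1 / |Real.cos b|)) := by
  have hre : 0 < (a + b * Complex.I : ℂ).re := by simpa using ha.1
  have hc := norm_pos_iff.2 (cosh_ne_zero_of_re_pos hre)
  have hz := norm_pos_iff.2 (ne_zero_of_re_pos hre)
  rw [norm_whithamExt]
  refine Real.sqrt_le_sqrt ?_
  have hs0 : 0 ≤ Real.sinh a := Real.sinh_nonneg_iff.2 ha.1.le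
  have hs : Real.sinh a ≤ rexp 1 * a := by
    have h1 : 1 - 2 * a ≤ rexp (-(2 * a)) := by linarith [add_one_le_exp (-(2 * a))]
    have h2 : rexp (-a) = rexp a * rexp (-(2 * a)) := by
      rw [← Real.exp_add]; ring_nf
    have h3 : rexp a ≤ rexp 1 := Real.exp_le_exp.2 ha.2
    rw [Real.sinh_eq, h2]
    have := ha.1
    have := exp_pos a
    nlinarith
  have he : 1 ≤ rexp 1 := Real.one_le_exp (by norm_num)
  have h1 : ‖Complex.sinh (a + b * Complex.I)‖ ≤ rexp 1 * ‖(a + b * Complex.I : ℂ)‖ := by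
    refine abs_le_of_sq_le_sq' ?_ (by positivity) |>.2
    rw [mul_pow, norm_sq_sinh, norm_sq_add_mul_I, mul_add]
    have hb2 : Real.sin b ^ 2 ≤ b ^ 2 := sq_le_sq.2 Real.abs_sin_le_abs
    have : Real.sinh a ^ 2 ≤ rexp 1 ^ 2 * a ^ 2 := by rw [← mul_pow]; gcongr
    have : b ^ 2 ≤ rexp 1 ^ 2 * b ^ 2 := le_mul_of_one_le_left (sq_nonneg b) (by nlinarith)
    linarith
  have h2 : |Real.cos b| ≤ ‖Complex.cosh (a + b * Complex.I)‖ := by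
    refine abs_le_of_sq_le_sq' ?_ (by positivity) |>.2
    rw [norm_sq_cosh, sq_abs]
    nlinarith [sq_nonneg (Real.sinh a)]
  have h3 : 0 < |Real.cos b| := abs_pos.2 hb
  rw [div_div, div_le_iff₀ (by positivity)]
  refine h1.trans ?_
  rw [mul_one_div, div_mul_eq_mul_div, le_div_iff₀ h3, mul_assoc]
  have : 0 < rexp 1 := exp_pos _
  rw [mul_comm ‖_‖ |_|]
  gcongr

lemma whithamExt_ofReal {ξ : ℝ} (hξ : 0 < ξ) : whithamExt ξ = whithamSymbol ξ := by
  have h : 0 ≤ Real.tanh ξ / ξ := by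
    have := Real.sinh_pos_iff.2 hξ
    have := Real.cosh_pos ξ
    rw [Real.tanh_eq_sinh_div_cosh]
    positivity
  rw [whithamExt, whithamSymbol, if_neg hξ.ne', Real.sqrt_eq_rpow, Complex.ofReal_cpow h]
  push_cast
  rfl

/-- Boundary values of `whithamExt` on the positive imaginary axis. -/
lemma tendsto_whithamExt {y : ℝ} (hy : 0 < y) (hc : Real.cos y ≠ 0) (hs : Real.sin y ≠ 0) :
    Tendsto (fun ε : ℝ => whithamExt (ε + y * Complex.I)) (𝓝[>] 0)
      (𝓝 (√(Real.tan y / y) - Complex.I * √(-Real.tan y / y))) := by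
  have hcos : Complex.cosh (y * Complex.I) ≠ 0 := by
    rw [Complex.cosh_mul_I]; exact_mod_cast hc
  have hval : Complex.tanh (y * Complex.I) / (y * Complex.I) = ((Real.tan y / y : ℝ) : ℂ) := by
    rw [Complex.tanh_mul_I, mul_div_mul_right _ _ Complex.I_ne_zero]
    push_cast
    rfl
  have hq : Tendsto (fun ε : ℝ => Complex.tanh (ε + y * Complex.I) / (ε + y * Complex.I))
      (𝓝[>] 0) (𝓝 ((Real.tan y / y : ℝ) : ℂ)) := by
    have : ContinuousAt
        (fun ε : ℝ => Complex.tanh (ε + y * Complex.I) / (ε + y * Complex.I)) 0 := by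
      simp only [Complex.tanh_eq_sinh_div_cosh]
      refine (ContinuousAt.div (by fun_prop) (by fun_prop) ?_).div (by fun_prop) ?_
      · simpa using hcos
      · simpa using hy.ne'
    have := this.tendsto.mono_left (nhdsWithin_le_nhds (s := Set.Ioi 0))
    rw [← hval]
    simpa using this
  have ht : Real.tan y ≠ 0 := by
    rw [Real.tan_eq_sin_div_cos]; exact div_ne_zero hs hc
  rcases lt_or_gt_of_ne ht with h | h
  · have hneg : Real.tan y / y < 0 := div_neg_of_neg_of_pos h hy
    have hpos : 0 < -Real.tan y / y := div_pos (by linarith) hy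
    rw [Real.sqrt_eq_zero_of_nonpos hneg.le]
    have hq' : Tendsto (fun ε : ℝ => Complex.tanh (ε + y * Complex.I) / (ε + y * Complex.I))
        (𝓝[>] 0) (𝓝[{z | z.im < 0}] ((Real.tan y / y : ℝ) : ℂ)) := by
      refine tendsto_nhdsWithin_iff.2 ⟨hq, ?_⟩
      filter_upwards [self_mem_nhdsWithin] with ε hε
      exact tanh_div_self_im_neg (by simpa using hε) (by simpa using hy)
    have hlog := (Complex.tendsto_log_nhdsWithin_im_neg_of_re_neg_of_im_zero
      (z := ((Real.tan y / y : ℝ) : ℂ)) (by simpa only [Complex.ofReal_re] using hneg)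
      (Complex.ofReal_im _)).comp hq'
    have := (Complex.continuous_exp.tendsto _).comp (hlog.mul_const (1 / 2 : ℂ))
    refine (this.congr' ?_).trans (le_of_eq ?_)
    · filter_upwards [self_mem_nhdsWithin] with ε hε
      have : (0 : ℝ) < (ε + y * Complex.I : ℂ).re := by simpa using hε
      rw [whithamExt, Complex.cpow_def_of_ne_zero
        (Complex.slitPlane_ne_zero (tanh_div_self_mem_slitPlane this))]
      rfl
    · congr 1
      have e : Complex.exp (-(π / 2 : ℝ) * Complex.I) = -Complex.I := by
        have := Complex.exp_neg_pi_div_two_mul_I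
        rw [← this]
        congr 1
        push_cast
        ring
      have e2 : ((Real.log ‖((Real.tan y / y : ℝ) : ℂ)‖ : ℂ) - π * Complex.I) * (1 / 2) =
        ((Real.log (-Real.tan y / y) * (1 / 2) : ℝ) : ℂ) + (-(π / 2 : ℝ) * Complex.I) := by
        rw [Complex.norm_real, Real.norm_of_nonpos hneg.le, neg_div]
        push_cast
        ring
      rw [e2, Complex.exp_add, e, Real.sqrt_eq_rpow (-Real.tan y / y), Real.rpow_def_of_pos hpos]
      push_cast
      ring
  · have hpos : 0 < Real.tan y / y := div_pos h hy
    have hneg : -Real.tan y / y < 0 := div_neg_of_neg_of_pos (by linarith) hy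
    rw [Real.sqrt_eq_zero_of_nonpos hneg.le]
    have := hq.cpow (tendsto_const_nhds (x := (1 / 2 : ℂ)))
      (Or.inl (by simpa only [Complex.ofReal_re] using hpos))
    refine this.trans (le_of_eq ?_)
    rw [Real.sqrt_eq_rpow, Complex.ofReal_cpow hpos.le]
    simp

/-- A nonnegative locally integrable periodic function times a decaying exponential is
integrable on the half-line. -/
lemma integrableOn_periodic_mul_exp {p : ℝ → ℝ} {L x : ℝ} (hL : 0 < L) (hx : 0 < x)
    (hp : Function.Periodic p L) (hp0 : ∀ y, 0 ≤ p y) (hi : IntervalIntegrable p volume 0 L) :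
    IntegrableOn (fun y => p y * rexp (-x * y)) (Set.Ioi 0) := by
  have hfint : ∀ a b : ℝ, IntervalIntegrable (fun y => p y * rexp (-x * y)) volume a b :=
    fun a b => (hp.intervalIntegrable₀ hL.ne' hi a b).mul_continuousOn (by fun_prop)
  have hsum : Summable fun n : ℕ => rexp (n * (-x * L)) :=
    Real.summable_exp_nat_mul_iff.2 (by nlinarith)
  set A := ∫ y in (0 : ℝ)..L, p y
  have hA : 0 ≤ A := intervalIntegral.integral_nonneg hL.le fun y _ => hp0 y
  refine integrableOn_Ioi_of_intervalIntegral_norm_bounded (l := atTop)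
    (b := fun n : ℕ => (n : ℝ) * L) (∑' n : ℕ, rexp (n * (-x * L)) * A) 0 ?_ ?_ ?_
  · intro n
    exact (intervalIntegrable_iff_integrableOn_Ioc_of_le (by positivity)).1 (hfint 0 (n * L))
  · exact tendsto_natCast_atTop_atTop.atTop_mul_const hL
  · refine Eventually.of_forall fun n => ?_
    have e := intervalIntegral.sum_integral_adjacent_intervals
      (f := fun y => p y * rexp (-x * y)) (μ := volume) (a := fun n : ℕ => (n : ℝ) * L) (n := n)
      (fun k _ => hfint _ _)
    have hnorm : ∀ y, ‖p y * rexp (-x * y)‖ = p y * rexp (-x * y) := fun y =>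
      Real.norm_of_nonneg (mul_nonneg (hp0 y) (exp_pos _).le)
    simp only [hnorm]
    rw [Nat.cast_zero, zero_mul] at e
    rw [← e]
    refine le_trans (Finset.sum_le_sum fun k _ => ?_)
      ((hsum.mul_right A).sum_le_tsum _ fun k _ => by positivity)
    have hA' : A = ∫ y in (k * L : ℝ)..((k + 1 : ℕ) * L : ℝ), p y := by
      have := hp.intervalIntegral_add_eq 0 (k * L)
      rw [zero_add] at this
      rw [show ((k + 1 : ℕ) * L : ℝ) = k * L + L by push_cast; ring]
      exact this
    rw [hA', ← intervalIntegral.integral_const_mul]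
    have hk : (k * L : ℝ) ≤ (k + 1 : ℕ) * L := by push_cast; nlinarith
    refine intervalIntegral.integral_mono_on hk (hfint _ _)
      ((hp.intervalIntegrable₀ hL.ne' hi _ _).const_mul _) fun y hy => ?_
    rw [mul_comm]
    exact mul_le_mul_of_nonneg_right (Real.exp_le_exp.2 (by nlinarith [hy.1])) (hp0 y)

lemma intervalIntegrable_sqrt_inv_abs_cos (E : ℝ) :
    IntervalIntegrable (fun y => √(E * (1 / |Real.cos y|))) volume 0 π := by
  have hs : IntervalIntegrable (fun t => √(E * (1 / |Real.sin t|))) volume 0 (π / 2) := by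
    refine IntervalIntegrable.mono_fun' (g := fun t => √E * √(π / 2) * t ^ (-1 / 2 : ℝ)) ?_ ?_ ?_
    · exact (intervalIntegral.intervalIntegrable_rpow' (by norm_num)).const_mul _
    · exact Measurable.aestronglyMeasurable (by fun_prop)
    · rw [Set.uIoc_of_le (by positivity)]
      filter_upwards [ae_restrict_mem measurableSet_Ioc] with t ht
      have h := Real.mul_le_sin ht.1.le ht.2
      have ht0 := ht.1
      have hsin : 0 < Real.sin t := lt_of_lt_of_le (by positivity) h
      rw [Real.norm_of_nonneg (Real.sqrt_nonneg _), abs_of_pos hsin,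
        Real.sqrt_mul' _ (by positivity), mul_assoc]
      gcongr
      rw [show (-1 / 2 : ℝ) = -(1 / 2) by ring, Real.rpow_neg ht0.le, ← Real.sqrt_eq_rpow,
        ← Real.sqrt_inv, ← Real.sqrt_mul (by positivity)]
      refine Real.sqrt_le_sqrt ?_
      rw [div_le_iff₀ hsin]
      calc (1 : ℝ) = π / 2 * t⁻¹ * (2 / π * t) := by field_simp
        _ ≤ _ := by gcongr
  have h1 := (hs.comp_sub_left (π / 2)).symm
  have h2 := hs.comp_sub_right (π / 2)
  simp only [Real.sin_pi_div_two_sub, sub_self, sub_zero] at h1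
  simp only [Real.sin_sub_pi_div_two, abs_neg, zero_add, add_halves] at h2
  exact h1.trans h2

lemma ae_cos_ne_zero : ∀ᵐ y : ℝ, Real.cos y ≠ 0 := by
  have : {y : ℝ | ¬ Real.cos y ≠ 0} = Set.range fun k : ℤ => (2 * k + 1) * π / 2 := by
    ext y
    rw [Set.mem_ofPred_eq, not_not, Real.cos_eq_zero_iff]
    simp [eq_comm]
  rw [ae_iff, this]
  exact (Set.countable_range _).measure_zero _

lemma ae_sin_ne_zero : ∀ᵐ y : ℝ, Real.sin y ≠ 0 := by
  have : {y : ℝ | ¬ Real.sin y ≠ 0} = Set.range fun k : ℤ => (k : ℝ) * π := by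
    ext y
    simp [Real.sin_eq_zero_iff]
  rw [ae_iff, this]
  exact (Set.countable_range _).measure_zero _

lemma whithamSymbol_nonneg (ξ : ℝ) : 0 ≤ whithamSymbol ξ := by
  unfold whithamSymbol
  split_ifs
  · norm_num
  · exact Real.sqrt_nonneg _

lemma measurable_whithamSymbol : Measurable whithamSymbol := by
  unfold whithamSymbol
  refine Measurable.ite (measurableSet_singleton 0) measurable_const ?_
  have : Measurable Real.tanh := by
    simp only [funext Real.tanh_eq_sinh_div_cosh]
    fun_prop
  fun_prop

lemma tanh_pos_of_pos {ξ : ℝ} (hξ : 0 < ξ) : 0 < Real.tanh ξ := by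
  have := Real.sinh_pos_iff.2 hξ
  have := Real.cosh_pos ξ
  rw [Real.tanh_eq_sinh_div_cosh]
  positivity

lemma whithamSymbol_of_pos {ξ : ℝ} (hξ : 0 < ξ) :
    whithamSymbol ξ = √(Real.tanh ξ) * ξ ^ (-1 / 2 : ℝ) := by
  rw [whithamSymbol, if_neg hξ.ne', show (-1 / 2 : ℝ) = -(1 / 2) by ring, Real.rpow_neg hξ.le,
    ← Real.sqrt_eq_rpow, Real.sqrt_div (tanh_pos_of_pos hξ).le, div_eq_mul_inv]

lemma whithamSymbol_le {ξ : ℝ} (hξ : 0 < ξ) : whithamSymbol ξ ≤ ξ ^ (-1 / 2 : ℝ) := by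
  rw [whithamSymbol_of_pos hξ]
  refine mul_le_of_le_one_left (by positivity) ?_
  exact Real.sqrt_le_one.2 (Real.tanh_lt_one ξ).le

lemma intervalIntegrable_whithamSymbol {R : ℝ} (hR : 0 < R) :
    IntervalIntegrable whithamSymbol volume 0 R := by
  refine IntervalIntegrable.mono_fun' (g := fun ξ => ξ ^ (-1 / 2 : ℝ))
    (intervalIntegral.intervalIntegrable_rpow' (by norm_num))
    measurable_whithamSymbol.aestronglyMeasurable ?_
  rw [Set.uIoc_of_le hR.le]
  filter_upwards [ae_restrict_mem measurableSet_Ioc] with ξ hξ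
  rw [Real.norm_of_nonneg (whithamSymbol_nonneg ξ)]
  exact whithamSymbol_le hξ.1

/-- The density of the representing measure of the Whitham kernel, up to a factor `π`. -/
noncomputable def whithamDensity (y : ℝ) : ℝ := √(-Real.tan y / y)

lemma measurable_whithamDensity : Measurable whithamDensity := by
  unfold whithamDensity
  have : Measurable Real.tan := by
    simp only [funext Real.tan_eq_sin_div_cos]
    fun_prop
  fun_prop

lemma whithamDensity_nonneg (y : ℝ) : 0 ≤ whithamDensity y := Real.sqrt_nonneg _

lemma whithamDensity_eq_zero {y : ℝ} (hy : y ∈ Set.Ioc 0 1) : whithamDensity y = 0 := by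
  refine Real.sqrt_eq_zero_of_nonpos (div_nonpos_of_nonpos_of_nonneg ?_ hy.1.le)
  have := Real.tan_pos_of_pos_of_lt_pi_div_two hy.1 (by linarith [hy.2, Real.pi_gt_three])
  linarith

lemma tendsto_integral_whithamSymbol_mul_cos {x : ℝ} (hx : 0 < x) :
    IntegrableOn (fun y => whithamDensity y * rexp (-x * y)) (Set.Ioi 0) ∧
    Tendsto (fun R : ℝ => ∫ ξ in (0 : ℝ)..R, whithamSymbol ξ * Real.cos (x * ξ)) atTop
      (𝓝 (∫ y in Set.Ioi (0 : ℝ), whithamDensity y * rexp (-x * y))) := by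
  have hper : Function.Periodic (fun y => √(rexp 1 * (1 / |Real.cos y|))) π := by
    intro y
    simp [Real.cos_add_pi]
  have hgi := integrableOn_periodic_mul_exp pi_pos hx hper (fun y => Real.sqrt_nonneg _)
    (intervalIntegrable_sqrt_inv_abs_cos _)
  have hTc : ∀ n : ℕ, |Real.cos ((n : ℝ) * π)| = 1 := fun n => by
    rw [Real.cos_nat_mul_pi, abs_pow, abs_neg, abs_one, one_pow]
  have key := tendsto_integral_mul_cos (F := whithamExt)
    (F₀ := fun y : ℝ => √(Real.tan y / y) - Complex.I * √(-Real.tan y / y)) (f := whithamSymbol)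
    (C := √2) (D := √(rexp 1 * (1 / 1))) (T := fun n => (n : ℝ) * π) hx
    differentiableOn_whithamExt (fun z => norm_whithamExt_le) ?_ hgi
    (tendsto_natCast_atTop_atTop.atTop_mul_const pi_pos) ?_ ?_ ?_
    (fun ξ hξ => whithamExt_ofReal hξ) (fun R hR => intervalIntegrable_whithamSymbol hR)
  · have e : ∀ y : ℝ, -((√(Real.tan y / y) : ℂ) - Complex.I * √(-Real.tan y / y)).im =
        whithamDensity y := by
      intro y
      simp [whithamDensity]
    simpa only [e] using key
  · filter_upwards [ae_restrict_of_ae ae_cos_ne_zero] with y hy ε hε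
    exact norm_whithamExt_le' hε hy
  · intro n ε hε
    have := norm_whithamExt_le' hε (b := n * π) (by
      intro h; have := hTc n; rw [h] at this; simp at this)
    rwa [hTc n] at this
  · filter_upwards [ae_restrict_mem measurableSet_Ioi, ae_restrict_of_ae ae_cos_ne_zero,
      ae_restrict_of_ae ae_sin_ne_zero] with y hy hc hs
    exact tendsto_whithamExt hy hc hs
  · have : Measurable Real.tan := by
      simp only [funext Real.tan_eq_sin_div_cos]
      fun_prop
    fun_prop

lemma integrableOn_whithamDensity {x : ℝ} (hx : 0 < x) :
    IntegrableOn (fun y => whithamDensity y * rexp (-x * y)) (Set.Ioi 1) :=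
  (tendsto_integral_whithamSymbol_mul_cos hx).1.mono_set (Set.Ioi_subset_Ioi zero_le_one)

/-- The Whitham kernel as a Laplace transform. -/
lemma whithamKernel_eq_integral {x : ℝ} (hx : 0 < x) :
    whithamKernel x = 1 / π * ∫ y in Set.Ioi (1 : ℝ), whithamDensity y * rexp (-x * y) := by
  have h := tendsto_integral_whithamSymbol_mul_cos hx
  rw [whithamKernel, if_neg hx.ne', (h.2.const_mul (1 / π)).limUnder_eq]
  congr 1
  refine setIntegral_eq_of_subset_of_forall_sdiff_eq_zero measurableSet_Ioi
    (Set.Ioi_subset_Ioi zero_le_one) ?_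
  rintro y ⟨h0, h1⟩
  rw [whithamDensity_eq_zero ⟨h0, not_lt.1 h1⟩, zero_mul]

lemma whithamKernel_neg (x : ℝ) : whithamKernel (-x) = whithamKernel x := by
  simp [whithamKernel]

lemma whithamKernel_abs (x : ℝ) : whithamKernel |x| = whithamKernel x := by
  rcases abs_choice x with h | h <;> rw [h]
  exact whithamKernel_neg x

/-- The measure whose Laplace transform is the one-sided sum `t ↦ ∑ n : ℕ, K (t + n P)` of the
Whitham kernel `K`. -/
noncomputable def periodisedMeasure (P : ℝ) : Measure ℝ :=
  (volume.restrict (Set.Ioi 1)).withDensity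
    fun y => (whithamDensity y * (π * (1 - rexp (-P * y)))⁻¹).toNNReal

lemma measurable_periodisedMeasure_density (P : ℝ) :
    Measurable fun y => (whithamDensity y * (π * (1 - rexp (-P * y)))⁻¹).toNNReal :=
  (measurable_whithamDensity.mul (by fun_prop)).real_toNNReal

lemma one_sub_exp_pos {P y : ℝ} (hP : 0 < P) (hy : 0 < y) : 0 < 1 - rexp (-P * y) :=
  sub_pos.2 (Real.exp_lt_one_iff.2 (by nlinarith))

lemma integral_periodisedMeasure {P : ℝ} (hP : 0 < P) (f : ℝ → ℝ) :
    ∫ y, f y ∂periodisedMeasure P =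
      ∫ y in Set.Ioi 1, whithamDensity y * (π * (1 - rexp (-P * y)))⁻¹ * f y := by
  rw [periodisedMeasure,
    integral_withDensity_eq_integral_smul (measurable_periodisedMeasure_density P)]
  refine setIntegral_congr_fun measurableSet_Ioi fun y hy => ?_
  have := one_sub_exp_pos hP (zero_lt_one.trans hy)
  have := whithamDensity_nonneg y
  simp only [NNReal.smul_def, smul_eq_mul]
  rw [Real.coe_toNNReal _ (by positivity)]

lemma ae_periodisedMeasure (P : ℝ) : ∀ᵐ y ∂periodisedMeasure P, 1 < y :=
  (withDensity_absolutelyContinuous _ _).ae_le (ae_restrict_mem measurableSet_Ioi)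

lemma periodisedMeasure_ne_zero {P : ℝ} (hP : 0 < P) : periodisedMeasure P ≠ 0 := by
  intro h
  rw [periodisedMeasure, withDensity_eq_zero_iff
    (measurable_periodisedMeasure_density P).coe_nnreal_ennreal.aemeasurable] at h
  have h' := ae_restrict_of_ae_restrict_of_subset (s := Set.Ioo (π / 2) π)
    (fun y hy => Set.mem_Ioi.2 (by linarith [hy.1, Real.pi_gt_three])) h
  have : ∀ᵐ y ∂volume.restrict (Set.Ioo (π / 2) π), False := by
    filter_upwards [h', ae_restrict_mem measurableSet_Ioo] with y hy hmem
    have hy0 : 0 < y := by linarith [hmem.1, Real.pi_pos]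
    have h1 := one_sub_exp_pos hP hy0
    have htan : 0 < -Real.tan y := by
      have := Real.tan_neg_of_neg_of_pi_div_two_lt (x := y - π) (by linarith [hmem.2])
        (by linarith [hmem.1])
      rw [Real.tan_sub_pi] at this
      linarith
    have h2 : 0 < whithamDensity y := Real.sqrt_pos.2 (by positivity)
    simp only [Pi.zero_apply, ENNReal.coe_eq_zero, Real.toNNReal_eq_zero] at hy
    have : 0 < whithamDensity y * (π * (1 - rexp (-P * y)))⁻¹ := by positivity
    linarith
  rw [eventually_false_iff_eq_bot, ae_eq_bot, Measure.restrict_eq_zero, Real.volume_Ioo,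
    ENNReal.ofReal_eq_zero] at this
  linarith [Real.pi_pos]

lemma integrable_exp_periodisedMeasure {P t : ℝ} (hP : 0 < P) (ht : 0 < t) :
    Integrable (fun y => rexp (t * -y)) (periodisedMeasure P) := by
  rw [periodisedMeasure,
    integrable_withDensity_iff_integrable_smul (measurable_periodisedMeasure_density P)]
  refine ((integrableOn_whithamDensity ht).const_mul (π * (1 - rexp (-P)))⁻¹).mono' ?_ ?_
  · exact ((measurable_periodisedMeasure_density P).smul (by fun_prop)).aestronglyMeasurable
  · filter_upwards [ae_restrict_mem measurableSet_Ioi] with y hy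
    have hy1 : 1 < y := hy
    have h1 := one_sub_exp_pos hP (zero_lt_one.trans hy1)
    have h2 := one_sub_exp_pos hP zero_lt_one
    rw [mul_one] at h2
    have h3 := whithamDensity_nonneg y
    simp only [NNReal.smul_def, smul_eq_mul]
    rw [Real.coe_toNNReal _ (by positivity), Real.norm_of_nonneg (by positivity),
      mul_neg, ← neg_mul, mul_comm (whithamDensity y), mul_assoc]
    gcongr
    nlinarith

lemma Ioi_subset_interior_integrableExpSet {P : ℝ} (hP : 0 < P) :
    Set.Ioi 0 ⊆ interior
      (ProbabilityTheory.integrableExpSet (fun y : ℝ => -y) (periodisedMeasure P)) :=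
  interior_maximal (fun _ ht => integrable_exp_periodisedMeasure hP ht) isOpen_Ioi

lemma integral_pos_of_ae_pos {α : Type*} [MeasurableSpace α] {μ : Measure α} {f : α → ℝ}
    (hμ : μ ≠ 0) (hf : Integrable f μ) (h : ∀ᵐ a ∂μ, 0 < f a) : 0 < ∫ a, f a ∂μ := by
  have h0 : 0 ≤ᵐ[μ] f := h.mono fun _ => le_of_lt
  refine lt_of_le_of_ne (integral_nonneg_of_ae h0) fun he => ?_
  have hz := (integral_eq_zero_iff_of_nonneg_ae h0 hf).1 he.symm
  have : ∀ᵐ a ∂μ, False := by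
    filter_upwards [h, hz] with a ha hb
    exact ha.ne' hb
  rw [eventually_false_iff_eq_bot, ae_eq_bot] at this
  exact hμ this

/-- The one-sided sum `t ↦ ∑ n : ℕ, K (t + n P)` of the Whitham kernel `K`. -/
noncomputable def halfPeriodisedKernel (P : ℝ) : ℝ → ℝ :=
  ProbabilityTheory.mgf (fun y => -y) (periodisedMeasure P)

lemma whithamKernel_eq_integral_periodisedMeasure {P x : ℝ} (hP : 0 < P) (hx : 0 < x) :
    whithamKernel x = ∫ y, (rexp (x * -y) - rexp ((x + P) * -y)) ∂periodisedMeasure P := by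
  rw [whithamKernel_eq_integral hx, integral_periodisedMeasure hP, ← integral_const_mul]
  refine setIntegral_congr_fun measurableSet_Ioi fun y hy => ?_
  have := one_sub_exp_pos hP (zero_lt_one.trans hy)
  have e : rexp (x * -y) - rexp ((x + P) * -y) = rexp (-x * y) * (1 - rexp (-P * y)) := by
    rw [mul_sub, ← Real.exp_add, mul_one]
    ring_nf
  simp only [e]
  set q := 1 - rexp (-P * y)
  field_simp

lemma whithamKernel_eq_sub {P x : ℝ} (hP : 0 < P) (hx : 0 < x) :
    whithamKernel x = halfPeriodisedKernel P x - halfPeriodisedKernel P (x + P) := by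
  rw [whithamKernel_eq_integral_periodisedMeasure hP hx, integral_sub]
  · rfl
  · exact integrable_exp_periodisedMeasure hP hx
  · exact integrable_exp_periodisedMeasure hP (by positivity)

lemma whithamKernel_pos {x : ℝ} (hx : x ≠ 0) : 0 < whithamKernel x := by
  rw [← whithamKernel_abs]
  have hx' := abs_pos.2 hx
  rw [whithamKernel_eq_integral_periodisedMeasure zero_lt_one hx']
  refine integral_pos_of_ae_pos (periodisedMeasure_ne_zero zero_lt_one)
    ((integrable_exp_periodisedMeasure zero_lt_one hx').sub
      (integrable_exp_periodisedMeasure zero_lt_one (by positivity))) ?_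
  filter_upwards [ae_periodisedMeasure 1] with y hy
  rw [sub_pos, Real.exp_lt_exp]
  nlinarith

lemma whithamKernel_nonneg (x : ℝ) : 0 ≤ whithamKernel x := by
  rcases eq_or_ne x 0 with rfl | hx
  · simp [whithamKernel]
  · exact (whithamKernel_pos hx).le

lemma halfPeriodisedKernel_add_le {P t s : ℝ} (hP : 0 < P) (ht : 0 < t) (hs : 0 ≤ s) :
    halfPeriodisedKernel P (t + s) ≤ rexp (-s) * halfPeriodisedKernel P t := by
  rw [halfPeriodisedKernel, ProbabilityTheory.mgf, ProbabilityTheory.mgf, ← integral_const_mul]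
  refine integral_mono_ae (integrable_exp_periodisedMeasure hP (by positivity))
    ((integrable_exp_periodisedMeasure hP ht).const_mul _) ?_
  filter_upwards [ae_periodisedMeasure P] with y hy
  rw [← Real.exp_add, Real.exp_le_exp]
  nlinarith

lemma hasSum_nat_whithamKernel {P t : ℝ} (hP : 0 < P) (ht : 0 < t) :
    HasSum (fun n : ℕ => whithamKernel (t + n * P)) (halfPeriodisedKernel P t) := by
  rw [hasSum_iff_tendsto_nat_of_nonneg fun n => whithamKernel_nonneg _]
  have e : ∀ n : ℕ, ∑ i ∈ Finset.range n, whithamKernel (t + i * P) =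
      halfPeriodisedKernel P t - halfPeriodisedKernel P (t + n * P) := by
    intro n
    have h := Finset.sum_range_sub' (fun i : ℕ => halfPeriodisedKernel P (t + i * P)) n
    rw [Nat.cast_zero, zero_mul, add_zero] at h
    rw [← h]
    refine Finset.sum_congr rfl fun i _ => ?_
    rw [whithamKernel_eq_sub hP (by positivity)]
    push_cast
    ring_nf
  simp only [e]
  have hz : Tendsto (fun n : ℕ => halfPeriodisedKernel P (t + n * P)) atTop (𝓝 0) := by
    refine squeeze_zero (fun n => ProbabilityTheory.mgf_nonneg)
      (fun n => halfPeriodisedKernel_add_le hP ht (by positivity)) ?_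
    rw [← zero_mul (halfPeriodisedKernel P t)]
    refine Tendsto.mul_const _ (Real.tendsto_exp_neg_atTop_nhds_zero.comp ?_)
    exact tendsto_natCast_atTop_atTop.atTop_mul_const hP
  simpa using hz.const_sub (halfPeriodisedKernel P t)

lemma hasSum_int_whithamKernel {P x : ℝ} (hx : x ∈ Set.Ioo 0 P) :
    HasSum (fun n : ℤ => whithamKernel (x + n * P))
      (halfPeriodisedKernel P x + halfPeriodisedKernel P (P - x)) := by
  have hP := hx.1.trans hx.2
  refine HasSum.of_nat_of_neg_add_one (by simpa using hasSum_nat_whithamKernel hP hx.1) ?_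
  convert hasSum_nat_whithamKernel hP (sub_pos.2 hx.2) using 2 with n
  rw [← whithamKernel_neg]
  push_cast
  ring_nf

lemma exists_add_int_mul_mem_Ioo {P x : ℝ} (hP : 0 < P) (hx : ¬ inLattice P x) :
    ∃ n : ℤ, x + n * P ∈ Set.Ioo 0 P := by
  refine ⟨-⌊x / P⌋, ?_, ?_⟩
  · have h1 := Int.floor_le (x / P)
    rw [le_div_iff₀ hP] at h1
    have h2 : x ≠ ⌊x / P⌋ * P := fun h => hx ⟨_, h⟩
    push_cast
    have := lt_of_le_of_ne h1 h2.symm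
    linarith
  · have h1 := Int.lt_floor_add_one (x / P)
    rw [div_lt_iff₀ hP] at h1
    push_cast
    linarith

lemma periodisedKernel_add_int_mul (P x : ℝ) (k : ℤ) :
    periodisedKernel P (x + k * P) = periodisedKernel P x := by
  unfold periodisedKernel
  rw [← (Equiv.addLeft k).tsum_eq fun n : ℤ => whithamKernel (x + n * P)]
  refine tsum_congr fun n => ?_
  rw [Equiv.coe_addLeft]
  push_cast
  ring_nf

lemma periodisedKernel_neg (P x : ℝ) : periodisedKernel P (-x) = periodisedKernel P x := by
  unfold periodisedKernel
  rw [← (Equiv.neg ℤ).tsum_eq fun n : ℤ => whithamKernel (x + n * P)]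
  refine tsum_congr fun n => ?_
  rw [Equiv.neg_apply, ← whithamKernel_neg]
  push_cast
  ring_nf

lemma periodisedKernel_eq {P x : ℝ} (hx : x ∈ Set.Ioo 0 P) :
    periodisedKernel P x = halfPeriodisedKernel P x + halfPeriodisedKernel P (P - x) :=
  (hasSum_int_whithamKernel hx).tsum_eq

lemma summable_whithamKernel {P x : ℝ} (hP : 0 < P) (hx : ¬ inLattice P x) :
    Summable fun n : ℤ => whithamKernel (x + n * P) := by
  obtain ⟨k, hk⟩ := exists_add_int_mul_mem_Ioo hP hx
  rw [← (Equiv.addLeft k).summable_iff]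
  convert (hasSum_int_whithamKernel hk).summable using 2 with n
  simp only [Function.comp_apply, Equiv.coe_addLeft]
  push_cast
  ring_nf

lemma periodisedKernel_pos {P x : ℝ} (hP : 0 < P) (hx : ¬ inLattice P x) :
    0 < periodisedKernel P x := by
  refine (summable_whithamKernel hP hx).tsum_pos (fun n => whithamKernel_nonneg _) 0
    (whithamKernel_pos ?_)
  intro h
  exact hx ⟨0, by simpa using h⟩

lemma iteratedDeriv_periodisedKernel {P x : ℝ} (hx : x ∈ Set.Ioo 0 P) (j : ℕ) :
    iteratedDeriv j (periodisedKernel P) x =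
      (-1) ^ j * ∫ y, y ^ j * (rexp (x * -y) + (-1) ^ j * rexp ((P - x) * -y))
        ∂periodisedMeasure P ∧
    Integrable (fun y => y ^ j * (rexp (x * -y) + (-1) ^ j * rexp ((P - x) * -y)))
        (periodisedMeasure P) := by
  have hP := hx.1.trans hx.2
  have m1 := Ioi_subset_interior_integrableExpSet hP hx.1
  have m2 := Ioi_subset_interior_integrableExpSet hP (sub_pos.2 hx.2)
  have i1 := ProbabilityTheory.integrable_pow_mul_exp_of_mem_interior_integrableExpSet m1 j
  have i2 := ProbabilityTheory.integrable_pow_mul_exp_of_mem_interior_integrableExpSet m2 j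
  have c1 : ContDiffAt ℝ j (halfPeriodisedKernel P) x :=
    (ProbabilityTheory.analyticAt_mgf m1).contDiffAt
  have c2 : ContDiffAt ℝ j (halfPeriodisedKernel P) (P - x) :=
    (ProbabilityTheory.analyticAt_mgf m2).contDiffAt
  have c3 : ContDiffAt ℝ j (fun x => halfPeriodisedKernel P (P - x)) x :=
    c2.comp x (by fun_prop)
  have ev : periodisedKernel P =ᶠ[𝓝 x]
      (halfPeriodisedKernel P + fun x => halfPeriodisedKernel P (P - x)) := by
    filter_upwards [isOpen_Ioo.mem_nhds hx] with z hz
    exact periodisedKernel_eq hz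
  have e : ∀ y : ℝ, y ^ j * (rexp (x * -y) + (-1) ^ j * rexp ((P - x) * -y)) =
      (-1) ^ j * ((-y) ^ j * rexp (x * -y)) + (-y) ^ j * rexp ((P - x) * -y) := by
    intro y
    have : ((-1 : ℝ) ^ j) * (-1) ^ j = 1 := by rw [← mul_pow]; norm_num
    rw [neg_pow y]
    linear_combination (-(y ^ j * rexp (x * -y))) * this
  simp only [e]
  refine ⟨?_, (i1.const_mul _).add i2⟩
  rw [ev.iteratedDeriv_eq, iteratedDeriv_add c1 c3, iteratedDeriv_comp_const_sub,
    integral_add (i1.const_mul _) i2, integral_const_mul, halfPeriodisedKernel]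
  beta_reduce
  rw [ProbabilityTheory.iteratedDeriv_mgf m1, ProbabilityTheory.iteratedDeriv_mgf m2, mul_add,
    ← mul_assoc, ← mul_pow]
  simp

lemma neg_one_pow_mul_iteratedDeriv_pos {P x : ℝ} (hx : x ∈ Set.Ioo 0 (P / 2)) (j : ℕ) :
    0 < (-1 : ℝ) ^ j * iteratedDeriv j (periodisedKernel P) x := by
  have hP : 0 < P := by linarith [hx.1, hx.2]
  obtain ⟨h, hi⟩ := iteratedDeriv_periodisedKernel (P := P) (x := x)
    ⟨hx.1, by linarith [hx.2]⟩ j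
  rw [h, ← mul_assoc, ← mul_pow]
  rw [neg_one_mul, neg_neg, one_pow, one_mul]
  refine integral_pos_of_ae_pos (periodisedMeasure_ne_zero hP) hi ?_
  filter_upwards [ae_periodisedMeasure P] with y hy
  refine mul_pos (by positivity) ?_
  have hlt : rexp ((P - x) * -y) < rexp (x * -y) := by
    rw [Real.exp_lt_exp]
    nlinarith [hx.2]
  have := Real.exp_pos ((P - x) * -y)
  rcases neg_one_pow_eq_or ℝ j with h | h <;> rw [h] <;> linarith

lemma contDiffAt_periodisedKernel {P x : ℝ} (hx : x ∈ Set.Ioo 0 P) :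
    ContDiffAt ℝ (⊤ : ℕ∞) (periodisedKernel P) x := by
  have hP := hx.1.trans hx.2
  have c1 : ContDiffAt ℝ (⊤ : ℕ∞) (halfPeriodisedKernel P) x :=
    (ProbabilityTheory.analyticAt_mgf (Ioi_subset_interior_integrableExpSet hP hx.1)).contDiffAt
  have c2 : ContDiffAt ℝ (⊤ : ℕ∞) (halfPeriodisedKernel P) (P - x) :=
    (ProbabilityTheory.analyticAt_mgf
      (Ioi_subset_interior_integrableExpSet hP (sub_pos.2 hx.2))).contDiffAt
  refine (c1.add (c2.comp x (f := fun x => P - x) (by fun_prop))).congr_of_eventuallyEq ?_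
  filter_upwards [isOpen_Ioo.mem_nhds hx] with z hz
  exact periodisedKernel_eq hz

lemma contDiffOn_periodisedKernel {P : ℝ} (hP : 0 < P) :
    ContDiffOn ℝ (⊤ : ℕ∞) (periodisedKernel P) {x : ℝ | ¬ inLattice P x} := by
  intro x hx
  obtain ⟨k, hk⟩ := exists_add_int_mul_mem_Ioo hP hx
  have := (contDiffAt_periodisedKernel hk).comp x (f := fun x => x + k * P) (by fun_prop)
  refine ContDiffAt.contDiffWithinAt (this.congr_of_eventuallyEq (Eventually.of_forall fun z => ?_))
  exact (periodisedKernel_add_int_mul P z k).symm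

lemma strictAntiOn_periodisedKernel (P : ℝ) :
    StrictAntiOn (periodisedKernel P) (Set.Ioo 0 (P / 2)) := by
  have hsub : ∀ x ∈ Set.Ioo 0 (P / 2), x ∈ Set.Ioo 0 P := fun x hx =>
    ⟨hx.1, by linarith [hx.1, hx.2]⟩
  refine strictAntiOn_of_deriv_neg (convex_Ioo _ _)
    (fun x hx => (contDiffAt_periodisedKernel (hsub x hx)).continuousAt.continuousWithinAt) ?_
  intro x hx
  rw [interior_Ioo] at hx
  simpa using neg_one_pow_mul_iteratedDeriv_pos hx 1

lemma convexOn_periodisedKernel (P : ℝ) : ConvexOn ℝ (Set.Ioo 0 P) (periodisedKernel P) := by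
  have hc : ContDiffOn ℝ (⊤ : ℕ∞) (periodisedKernel P) (Set.Ioo 0 P) := fun x hx =>
    (contDiffAt_periodisedKernel hx).contDiffWithinAt
  refine convexOn_of_deriv2_nonneg (convex_Ioo _ _) hc.continuousOn ?_ ?_ ?_
  · rw [interior_Ioo]
    exact hc.differentiableOn (by simp)
  · rw [interior_Ioo]
    exact (hc.deriv_of_isOpen (m := 1) isOpen_Ioo (by norm_cast)).differentiableOn (by simp)
  · intro x hx
    rw [interior_Ioo] at hx
    rw [← iteratedDeriv_eq_iterate, (iteratedDeriv_periodisedKernel hx 2).1]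
    norm_num
    exact integral_nonneg fun y => by positivity

/-- The deviation `ξ^(-1/2) - m(ξ)` of the Whitham symbol from its leading asymptotics. -/
noncomputable def whithamRemainder (ξ : ℝ) : ℝ := ξ ^ (-1 / 2 : ℝ) - whithamSymbol ξ

lemma measurable_whithamRemainder : Measurable whithamRemainder :=
  (measurable_id.pow_const _).sub measurable_whithamSymbol

lemma whithamRemainder_nonneg {ξ : ℝ} (hξ : 0 < ξ) : 0 ≤ whithamRemainder ξ :=
  sub_nonneg.2 (whithamSymbol_le hξ)

lemma whithamRemainder_le {ξ : ℝ} (hξ : 0 < ξ) :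
    whithamRemainder ξ ≤ 2 * rexp (-2 * ξ) * ξ ^ (-1 / 2 : ℝ) := by
  have h0 := tanh_pos_of_pos hξ
  have h1 := Real.tanh_lt_one ξ
  have hs : Real.tanh ξ ≤ √(Real.tanh ξ) := Real.le_sqrt_of_sq_le (by nlinarith)
  have hcosh := Real.cosh_pos ξ
  have ht : 1 - Real.tanh ξ ≤ 2 * rexp (-2 * ξ) := by
    rw [Real.tanh_eq_sinh_div_cosh, one_sub_div hcosh.ne', Real.cosh_sub_sinh,
      div_le_iff₀ hcosh, Real.cosh_eq]
    have e1 : rexp (-2 * ξ) * rexp ξ = rexp (-ξ) := by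
      rw [← Real.exp_add]
      ring_nf
    nlinarith [mul_pos (Real.exp_pos (-2 * ξ)) (Real.exp_pos (-ξ))]
  rw [whithamRemainder, whithamSymbol_of_pos hξ, ← one_sub_mul]
  gcongr
  linarith

/-- The measure on `(0, ∞)` with density `whithamRemainder`. -/
noncomputable def whithamRemainderMeasure : Measure ℝ :=
  (volume.restrict (Set.Ioi 0)).withDensity fun ξ => (whithamRemainder ξ).toNNReal

lemma integrable_exp_whithamRemainderMeasure {t : ℝ} (ht : t < 1) :
    Integrable (fun ξ => rexp (t * ξ)) whithamRemainderMeasure := by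
  have hm : Measurable fun ξ => (whithamRemainder ξ).toNNReal :=
    measurable_whithamRemainder.real_toNNReal
  rw [whithamRemainderMeasure, integrable_withDensity_iff_integrable_smul hm]
  have hG := Real.GammaIntegral_convergent (s := 1 / 2) (by norm_num)
  refine (hG.const_mul 2).mono' (hm.smul (by fun_prop)).aestronglyMeasurable ?_
  filter_upwards [ae_restrict_mem measurableSet_Ioi] with ξ hξ
  have hξ0 : 0 < ξ := hξ
  have h0 := whithamRemainder_nonneg hξ0
  simp only [NNReal.smul_def, smul_eq_mul]
  rw [Real.coe_toNNReal _ h0, Real.norm_of_nonneg (by positivity),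
    show (1 / 2 - 1 : ℝ) = -1 / 2 by norm_num]
  calc whithamRemainder ξ * rexp (t * ξ)
      ≤ 2 * rexp (-2 * ξ) * ξ ^ (-1 / 2 : ℝ) * rexp ξ := by
        gcongr
        · exact whithamRemainder_le hξ0
        · nlinarith
    _ = 2 * (rexp (-2 * ξ + ξ) * ξ ^ (-1 / 2 : ℝ)) := by
        rw [Real.exp_add]
        ring
    _ = 2 * (rexp (-ξ) * ξ ^ (-1 / 2 : ℝ)) := by ring_nf

lemma zero_mem_interior_integrableExpSet_whithamRemainderMeasure :
    0 ∈ interior (ProbabilityTheory.integrableExpSet id whithamRemainderMeasure) :=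
  interior_maximal (t := Set.Iio 1) (fun _ ht => integrable_exp_whithamRemainderMeasure ht)
    isOpen_Iio (Set.mem_Iio.2 zero_lt_one)

/-- The cosine transform of `whithamRemainder`. -/
noncomputable def whithamRemainderTransform (x : ℝ) : ℝ :=
  (ProbabilityTheory.complexMGF id whithamRemainderMeasure (x * Complex.I)).re

lemma contDiff_whithamRemainderTransform :
    ContDiff ℝ (⊤ : ℕ∞) whithamRemainderTransform := by
  rw [contDiff_iff_contDiffAt]
  intro x
  have h : ContDiffAt ℝ (⊤ : ℕ∞)
      (ProbabilityTheory.complexMGF id whithamRemainderMeasure) (x * Complex.I) :=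
    ((ProbabilityTheory.analyticAt_complexMGF
      (by simpa using zero_mem_interior_integrableExpSet_whithamRemainderMeasure)).contDiffAt
        (n := (⊤ : ℕ∞))).restrict_scalars ℝ
  have h1 : ContDiffAt ℝ (⊤ : ℕ∞) (fun x : ℝ => (x : ℂ) * Complex.I) x :=
    (Complex.ofRealCLM.contDiff.contDiffAt).mul contDiffAt_const
  exact Complex.reCLM.contDiff.contDiffAt.comp x
    (h.comp x (f := fun x : ℝ => (x : ℂ) * Complex.I)
      (g := ProbabilityTheory.complexMGF id whithamRemainderMeasure) h1)

lemma whithamRemainderTransform_eq (x : ℝ) :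
    whithamRemainderTransform x =
      ∫ ξ in Set.Ioi 0, whithamRemainder ξ * Real.cos (x * ξ) := by
  have hm : Measurable fun ξ => (whithamRemainder ξ).toNNReal :=
    measurable_whithamRemainder.real_toNNReal
  have hi := ProbabilityTheory.integrable_cexp_mul_of_re_mem_interior_integrableExpSet
    (z := x * Complex.I)
    (by simpa using zero_mem_interior_integrableExpSet_whithamRemainderMeasure)
  rw [whithamRemainderTransform, ProbabilityTheory.complexMGF, ← RCLike.re_eq_complex_re,
    ← integral_re hi, whithamRemainderMeasure, integral_withDensity_eq_integral_smul hm]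
  refine setIntegral_congr_fun measurableSet_Ioi fun ξ hξ => ?_
  simp only [NNReal.smul_def, smul_eq_mul]
  rw [Real.coe_toNNReal _ (whithamRemainder_nonneg hξ)]
  simp [Complex.exp_re]

lemma integrableOn_whithamRemainder_mul_cos (x : ℝ) :
    IntegrableOn (fun ξ => whithamRemainder ξ * Real.cos (x * ξ)) (Set.Ioi 0) := by
  have hG := Real.GammaIntegral_convergent (s := 1 / 2) (by norm_num)
  refine (hG.const_mul 2).mono'
    (measurable_whithamRemainder.mul (by fun_prop)).aestronglyMeasurable ?_
  filter_upwards [ae_restrict_mem measurableSet_Ioi] with ξ hξ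
  have hξ0 : 0 < ξ := hξ
  rw [norm_mul, Real.norm_of_nonneg (whithamRemainder_nonneg hξ0),
    show (1 / 2 - 1 : ℝ) = -1 / 2 by norm_num, ← mul_assoc]
  refine (mul_le_of_le_one_right (whithamRemainder_nonneg hξ0) (Real.abs_cos_le_one _)).trans
    ((whithamRemainder_le hξ0).trans ?_)
  gcongr
  linarith

lemma whithamKernel_eq_sub_whithamRemainderTransform {x : ℝ} (hx : x ≠ 0) :
    whithamKernel x = 1 / √(2 * π * |x|) - 1 / π * whithamRemainderTransform x := by
  wlog hpos : 0 < x generalizing x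
  · have hT : whithamRemainderTransform (-x) = whithamRemainderTransform x := by
      simp [whithamRemainderTransform_eq]
    have := this (neg_ne_zero.2 hx) (neg_pos.2 (lt_of_le_of_ne (not_lt.1 hpos) hx))
    rwa [whithamKernel_neg, abs_neg, hT] at this
  have h1 := (tendsto_integral_whithamSymbol_mul_cos hpos).2
  have h2 := tendsto_integral_rpow_mul_cos hpos
  have h3 := intervalIntegral_tendsto_integral_Ioi 0 (integrableOn_whithamRemainder_mul_cos x)
    tendsto_id
  have h4 : whithamRemainderTransform x = √(π / (2 * x)) - π * whithamKernel x := by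
    rw [whithamKernel, if_neg hx, (h1.const_mul (1 / π)).limUnder_eq, ← mul_assoc,
      mul_one_div_cancel Real.pi_ne_zero, one_mul, whithamRemainderTransform_eq]
    refine tendsto_nhds_unique h3 ((h2.sub h1).congr' ?_)
    filter_upwards [eventually_gt_atTop 0] with R hR
    rw [← intervalIntegral.integral_sub]
    · simp only [whithamRemainder, sub_mul, id]
    · exact (intervalIntegral.intervalIntegrable_rpow' (by norm_num)).mul_continuousOn
        (by fun_prop)
    · exact (intervalIntegrable_whithamSymbol hR).mul_continuousOn (by fun_prop)
  have h5 : √(π / (2 * x)) = π * (1 / √(2 * π * |x|)) := by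
    rw [abs_of_pos hpos, Real.sqrt_eq_iff_mul_self_eq (by positivity) (by positivity)]
    rw [mul_mul_mul_comm, div_mul_div_comm, Real.mul_self_sqrt (by positivity)]
    field_simp
  rw [h4, h5]
  field_simp
  ring

lemma exists_contDiffOn_periodisedKernel_eq {P : ℝ} (hP : 0 < P) :
    ∃ Kreg : ℝ → ℝ, ContDiffOn ℝ (⊤ : ℕ∞) Kreg (Set.Ioo (-P) P) ∧
      ∀ x ∈ Set.Ioo (-P) P, x ≠ 0 →
        periodisedKernel P x = 1 / √(2 * π * |x|) + Kreg x := by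
  refine ⟨fun x => halfPeriodisedKernel P (P + x) + halfPeriodisedKernel P (P - x) -
    1 / π * whithamRemainderTransform x, ?_, ?_⟩
  · have hc : ∀ t, 0 < t → ContDiffAt ℝ (⊤ : ℕ∞) (halfPeriodisedKernel P) t := fun t ht =>
      (ProbabilityTheory.analyticAt_mgf (Ioi_subset_interior_integrableExpSet hP ht)).contDiffAt
    intro x hx
    refine ContDiffAt.contDiffWithinAt (ContDiffAt.sub (ContDiffAt.add ?_ ?_) ?_)
    · exact (hc (P + x) (by linarith [hx.1])).comp x (f := fun x => P + x) (by fun_prop)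
    · exact (hc (P - x) (by linarith [hx.2])).comp x (f := fun x => P - x) (by fun_prop)
    · exact contDiffAt_const.mul contDiff_whithamRemainderTransform.contDiffAt
  · have key : ∀ x ∈ Set.Ioo 0 P, periodisedKernel P x = whithamKernel x +
        (halfPeriodisedKernel P (P + x) + halfPeriodisedKernel P (P - x)) := by
      intro x hx
      rw [periodisedKernel_eq hx, whithamKernel_eq_sub hP hx.1, add_comm P x]
      ring
    intro x hx h0
    have hK : periodisedKernel P x = whithamKernel x +
        (halfPeriodisedKernel P (P + x) + halfPeriodisedKernel P (P - x)) := by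
      rcases h0.lt_or_gt with hneg | hpos
      · rw [← periodisedKernel_neg, key (-x) ⟨by linarith, by linarith [hx.1]⟩,
          whithamKernel_neg, ← sub_eq_add_neg, sub_neg_eq_add,
          add_comm (halfPeriodisedKernel P (P - x))]
      · exact key x ⟨hpos, hx.2⟩
    rw [hK, whithamKernel_eq_sub_whithamRemainderTransform h0]
    ring

theorem periodised_kernel_properties (P : ℝ) (hP : 0 < P) :
    (∀ x : ℝ, ¬ inLattice P x → Summable (fun n : ℤ => |whithamKernel (x + n * P)|)) ∧
    (∀ x : ℝ, periodisedKernel P (x + P) = periodisedKernel P x) ∧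
    (∀ x : ℝ, periodisedKernel P (-x) = periodisedKernel P x) ∧
    (∀ x : ℝ, ¬ inLattice P x → 0 < periodisedKernel P x) ∧
    StrictAntiOn (periodisedKernel P) (Set.Ioo 0 (P / 2)) ∧
    ConvexOn ℝ (Set.Ioo 0 P) (periodisedKernel P) ∧
    ContDiffOn ℝ (⊤ : ℕ∞) (periodisedKernel P) {x : ℝ | ¬ inLattice P x} ∧
    (∀ j : ℕ, ∀ x ∈ Set.Ioo 0 (P / 2),
      0 < (-1 : ℝ) ^ j * iteratedDeriv j (periodisedKernel P) x) ∧
    (∃ Kreg : ℝ → ℝ, ContDiffOn ℝ (⊤ : ℕ∞) Kreg (Set.Ioo (-P) P) ∧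
      ∀ x ∈ Set.Ioo (-P) P, x ≠ 0 →
        periodisedKernel P x = 1 / Real.sqrt (2 * Real.pi * |x|) + Kreg x) := by
  refine ⟨fun x hx => (summable_whithamKernel hP hx).abs, fun x => ?_,
    periodisedKernel_neg P, fun x hx => periodisedKernel_pos hP hx,
    strictAntiOn_periodisedKernel P, convexOn_periodisedKernel P, contDiffOn_periodisedKernel hP,
    fun j x hx => neg_one_pow_mul_iteratedDeriv_pos hx j,
    exists_contDiffOn_periodisedKernel_eq hP⟩
  simpa using periodisedKernel_add_int_mul P x 1
end

section
/- Let f : ℝ → ℝ be continuously differentiable such that the limits lim_{x→∞} f(x) and lim_{x→−∞} f(x) exist (as finite real numbers), and let J : ℝ → ℝ be nonnegative, even, and integrable with ∫_ℝ J = 1 and ∫_ℝ J(y)|y| dy < ∞. Then lim_{R→∞} ∫_{−R}^{R} ((J ∗ f)(x) − f(x)) dx = 0, where (J ∗ f)(x) = ∫_ℝ J(x−y)f(y) dy. -/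
open Real Filter MeasureTheory

/-- A continuous real function with finite limits at `±∞` is bounded. -/
theorem exists_abs_le_of_tendsto_atTop_atBot {f : ℝ → ℝ} (hf : Continuous f) {a b : ℝ}
    (ha : Tendsto f atTop (nhds a)) (hb : Tendsto f atBot (nhds b)) :
    ∃ M, ∀ x, |f x| ≤ M := by
  obtain ⟨u, hu⟩ := eventually_atTop.1 (ha.abs.eventually_le_const (lt_add_one |a|))
  obtain ⟨v, hv⟩ := eventually_atBot.1 (hb.abs.eventually_le_const (lt_add_one |b|))
  obtain ⟨C, hC⟩ := (isCompact_Icc (a := v) (b := u)).exists_bound_of_continuousOn hf.continuousOn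
  refine ⟨max C (max (|a| + 1) (|b| + 1)), fun x => ?_⟩
  rcases le_total u x with h | h
  · exact (hu x h).trans ((le_max_left _ _).trans (le_max_right _ _))
  rcases le_total x v with h' | h'
  · exact (hv x h').trans ((le_max_right _ _).trans (le_max_right _ _))
  · exact (hC x ⟨h', h⟩).trans (le_max_left _ _)

/-- The integral of an increment of `f` over an interval is a boundary term. -/
theorem integral_comp_sub_right_sub_self {f : ℝ → ℝ} (hf : Continuous f) (u v z : ℝ) :
    ∫ x in u..v, (f (x - z) - f x) = ∫ t in (0 : ℝ)..z, (f (u - t) - f (v - t)) := by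
  have hi : ∀ c d, IntervalIntegrable f volume c d := hf.intervalIntegrable
  rw [intervalIntegral.integral_sub ((by fun_prop : Continuous _).intervalIntegrable _ _) (hi _ _),
    intervalIntegral.integral_sub ((by fun_prop : Continuous _).intervalIntegrable _ _)
      ((by fun_prop : Continuous _).intervalIntegrable _ _),
    intervalIntegral.integral_comp_sub_right, intervalIntegral.integral_comp_sub_left,
    intervalIntegral.integral_comp_sub_left]
  simp only [sub_zero]
  have h1 := intervalIntegral.integral_add_adjacent_intervals (hi (u - z) (v - z)) (hi (v - z) v)
  have h2 := intervalIntegral.integral_add_adjacent_intervals (hi (u - z) u) (hi u v)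
  linarith

/-- The regularisation defect of a convolution, integrated over an interval, as a weighted average
of boundary terms. -/
theorem integral_convolution_sub_self {f J : ℝ → ℝ} (hf : Continuous f) {M : ℝ}
    (hM : ∀ x, |f x| ≤ M) (hJint : Integrable J) (hJone : (∫ y : ℝ, J y) = 1) (u v : ℝ) :
    ∫ x in u..v, ((∫ y : ℝ, J (x - y) * f y) - f x) =
      ∫ z : ℝ, J z * ∫ t in (0 : ℝ)..z, (f (u - t) - f (v - t)) := by
  have hpt : ∀ x, (∫ y : ℝ, J (x - y) * f y) - f x = ∫ z : ℝ, J z * (f (x - z) - f x) := by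
    intro x
    have h1 : ∫ y : ℝ, J (x - y) * f y = ∫ z : ℝ, J z * f (x - z) := by
      rw [← integral_sub_left_eq_self (fun z => J z * f (x - z)) volume x]
      simp
    have hi : Integrable fun z => J z * f (x - z) :=
      hJint.mul_bdd (c := M) (by fun_prop : Continuous _).aestronglyMeasurable
        (Eventually.of_forall fun z => hM _)
    simp_rw [mul_sub]
    rw [integral_sub hi (hJint.mul_const _), integral_mul_const, hJone, one_mul, h1]
  simp_rw [hpt, ← integral_comp_sub_right_sub_self hf]
  rw [intervalIntegral_integral_swap]
  · simp_rw [intervalIntegral.integral_const_mul]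
  have : IsFiniteMeasure (volume.restrict (Set.uIoc u v)) := by
    rw [Set.uIoc]; infer_instance
  have hprod : Integrable (fun p : ℝ × ℝ => (1 : ℝ) * J p.2)
      ((volume.restrict (Set.uIoc u v)).prod volume) :=
    Integrable.mul_prod (integrable_const (1 : ℝ)) hJint
  have := hprod.mul_bdd (c := M + M) (g := fun p : ℝ × ℝ => f (p.1 - p.2) - f p.1)
    (by fun_prop : Continuous _).aestronglyMeasurable
    (Eventually.of_forall fun p => (norm_sub_le _ _).trans (add_le_add (hM _) (hM _)))
  simpa [Function.uncurry_def] using this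

theorem convolution_regularisation_lemma (f J : ℝ → ℝ)
    (hf : ContDiff ℝ 1 f)
    (hftop : ∃ a : ℝ, Tendsto f atTop (nhds a))
    (hfbot : ∃ b : ℝ, Tendsto f atBot (nhds b))
    (hJnonneg : ∀ y : ℝ, 0 ≤ J y)
    (hJeven : ∀ y : ℝ, J (-y) = J y)
    (hJint : Integrable J) (hJone : (∫ y : ℝ, J y) = 1)
    (hJmom : Integrable (fun y : ℝ => J y * |y|)) :
    Tendsto (fun R : ℝ => ∫ x in (-R)..R, ((∫ y : ℝ, J (x - y) * f y) - f x))
      atTop (nhds 0) := by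
  obtain ⟨a, ha⟩ := hftop
  obtain ⟨b, hb⟩ := hfbot
  have hc : Continuous f := hf.continuous
  obtain ⟨M, hM⟩ := exists_abs_le_of_tendsto_atTop_atBot hc ha hb
  have hbound : ∀ R t : ℝ, ‖f (-R - t) - f (R - t)‖ ≤ M + M := fun R t =>
    (norm_sub_le _ _).trans (add_le_add (hM _) (hM _))
  simp_rw [integral_convolution_sub_self hc hM hJint hJone]
  have hodd : ∫ z : ℝ, J z * ∫ _ in (0 : ℝ)..z, (b - a) = 0 := by
    have h := integral_neg_eq_self (fun z : ℝ => J z * ∫ _ in (0 : ℝ)..z, (b - a)) volume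
    simp only [intervalIntegral.integral_const, hJeven, sub_zero, smul_eq_mul, neg_mul, mul_neg,
      integral_neg] at h ⊢
    linarith
  conv => arg 3; rw [← hodd]
  refine tendsto_integral_filter_of_dominated_convergence (fun z => (M + M) * (J z * |z|))
    (Eventually.of_forall fun R => ?_)
    (Eventually.of_forall fun R => Eventually.of_forall fun z => ?_)
    (hJmom.const_mul _) (Eventually.of_forall fun z => ?_)
  · have hg : Continuous fun t => f (-R - t) - f (R - t) := by fun_prop
    exact hJint.aestronglyMeasurable.mul
      (intervalIntegral.continuous_primitive hg.intervalIntegrable 0).aestronglyMeasurable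
  · rw [norm_mul, Real.norm_of_nonneg (hJnonneg z)]
    have h := intervalIntegral.norm_integral_le_of_norm_le_const (a := 0) (b := z)
      fun t _ => hbound R t
    rw [sub_zero] at h
    calc _ ≤ J z * ((M + M) * |z|) := mul_le_mul_of_nonneg_left h (hJnonneg z)
      _ = _ := by ring
  · refine Tendsto.const_mul _ (intervalIntegral.tendsto_integral_filter_of_dominated_convergence
      (fun _ => M + M) (Eventually.of_forall fun R => ?_)
      (Eventually.of_forall fun R => Eventually.of_forall fun t _ => hbound R t)
      intervalIntegrable_const (Eventually.of_forall fun t _ => ?_))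
    · exact (by fun_prop : Continuous _).aestronglyMeasurable
    · exact (hb.comp (tendsto_atBot_add_const_right _ (-t) tendsto_neg_atTop_atBot)).sub
        (ha.comp (tendsto_atTop_add_const_right _ (-t) tendsto_id))
end

section
/- Let K : ℝ → ℝ be even, strictly positive, measurable and integrable with ∫_ℝ K = 1 and ∫_ℝ K(y)|y| dy < ∞. Let φ be a nonnegative solution of the steady Whitham equation with wave speed μ ≥ 0 (relative to K) such that the limits lim_{x→±∞} φ(x) exist (as finite real numbers). Then for every smooth, compactly supported function ψ : ℝ → ℝ with ψ ≥ 0 and ψ not identically zero, one has lim_{R→∞} ∫_{−R}^{R} (ψ ∗ (φ·((μ−1) − φ)))(x) dx = 0, where ∗ denotes convolution. -/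
open Real Filter MeasureTheory

/-- The convolution operator `Lf(x) = ∫_ℝ K(x−y) f(y) dy`. -/
noncomputable def Lop (K f : ℝ → ℝ) (x : ℝ) : ℝ := ∫ y : ℝ, K (x - y) * f y

/-- A solution of the steady Whitham equation with wave speed `μ`, relative to the
kernel `K`: a bounded measurable `φ` satisfying `−μφ + Lφ + φ² = 0` pointwise. -/
def IsSolution (K : ℝ → ℝ) (μ : ℝ) (φ : ℝ → ℝ) : Prop :=
  Measurable φ ∧ (∃ C : ℝ, ∀ x : ℝ, |φ x| ≤ C) ∧
    ∀ x : ℝ, -μ * φ x + Lop K φ x + (φ x) ^ 2 = 0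

lemma intervalIntegrable_of_bounded {f : ℝ → ℝ} (hf : Measurable f) {C : ℝ}
    (hC : ∀ x, |f x| ≤ C) (a b : ℝ) : IntervalIntegrable f volume a b :=
  (intervalIntegrable_const (c := C)).mono_fun hf.aestronglyMeasurable
    (ae_of_all _ fun x => (hC x).trans (le_abs_self C))

lemma interval_integral_swap_of_bounded {k : ℝ → ℝ} (hk : Integrable k) {F : ℝ → ℝ → ℝ}
    (hF : Measurable (Function.uncurry F)) {C : ℝ} (hC : ∀ x z, |F x z| ≤ C) (u v : ℝ) :
    (∫ x in u..v, ∫ z : ℝ, k z * F x z) = ∫ z : ℝ, k z * ∫ x in u..v, F x z := by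
  have : IsFiniteMeasure (volume.restrict (Set.uIoc u v)) := ⟨by simp [Set.uIoc]⟩
  rw [intervalIntegral_integral_swap]
  · simp only [intervalIntegral.integral_const_mul]
  · exact (hk.comp_snd _).mul_bdd hF.aestronglyMeasurable (ae_of_all _ fun p => hC p.1 p.2)

lemma continuous_integral_window {f : ℝ → ℝ} (hf : Measurable f) {C : ℝ}
    (hC : ∀ x, |f x| ≤ C) (u v : ℝ) : Continuous fun z : ℝ => ∫ x in (u - z)..v, f x := by
  have h := intervalIntegral.continuous_primitive (intervalIntegrable_of_bounded hf hC) v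
  simp only [fun z => intervalIntegral.integral_symm (μ := volume) (f := f) v (u - z)]
  exact (h.comp (continuous_const.sub continuous_id)).neg

/-- Integrals of a function with limit `a` over windows of width `z` moving to infinity converge
to `z * a`. -/
lemma tendsto_integral_window {f : ℝ → ℝ} (hf : Measurable f) {C : ℝ} (hC : ∀ x, |f x| ≤ C)
    {l : Filter ℝ} {a : ℝ} (hl : Tendsto f l (nhds a)) {u : ℝ → ℝ}
    (hu : ∀ t : ℝ, Tendsto (fun R => t + u R) atTop l) (z : ℝ) :
    Tendsto (fun R => ∫ x in (u R - z)..u R, f x) atTop (nhds (z * a)) := by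
  have key : Tendsto (fun R => ∫ t in (-z)..0, f (t + u R)) atTop
      (nhds (∫ _t in (-z)..0, a)) :=
    intervalIntegral.tendsto_integral_filter_of_dominated_convergence (fun _ => C)
      (.of_forall fun R => (hf.comp (measurable_id.add_const _)).aestronglyMeasurable)
      (.of_forall fun R => ae_of_all _ fun t _ => hC _) intervalIntegrable_const
      (ae_of_all _ fun t _ => hl.comp (hu t))
  simpa [intervalIntegral.integral_comp_add_right, neg_add_eq_sub] using key

lemma abs_integral_window_le {f : ℝ → ℝ} {C : ℝ} (hC : ∀ x, |f x| ≤ C) (u z : ℝ) :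
    |∫ x in (u - z)..u, f x| ≤ C * |z| := by
  simpa using intervalIntegral.norm_integral_le_of_norm_le_const
    (a := u - z) (b := u) (f := f) fun x _ => hC x

lemma abs_mul_window_sub_le {f : ℝ → ℝ} {k : ℝ} (hk : 0 < k) {C : ℝ} (hC : ∀ x, |f x| ≤ C)
    (u v z : ℝ) :
    |k * ((∫ x in (u - z)..u, f x) - ∫ x in (v - z)..v, f x)| ≤ 2 * C * (k * |z|) := by
  rw [abs_mul, abs_of_pos hk]
  nlinarith [abs_sub (∫ x in (u - z)..u, f x) (∫ x in (v - z)..v, f x),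
    abs_integral_window_le hC u z, abs_integral_window_le hC v z]

lemma Lop_eq_integral_translate (K f : ℝ → ℝ) (x : ℝ) :
    Lop K f x = ∫ z : ℝ, K z * f (x - z) := by
  rw [Lop, ← integral_sub_left_eq_self _ volume x]
  simp

/-- The integral of `Lf - f` over an interval only involves windows at its end points. -/
lemma integral_Lop_sub {K : ℝ → ℝ} (hK : Integrable K) (hKone : (∫ x : ℝ, K x) = 1)
    {f : ℝ → ℝ} (hf : Measurable f) {C : ℝ} (hC : ∀ x, |f x| ≤ C) (u v : ℝ) :
    (∫ x in u..v, (Lop K f x - f x)) =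
      ∫ z : ℝ, K z * ((∫ x in (u - z)..u, f x) - ∫ x in (v - z)..v, f x) := by
  have hpt (x : ℝ) : Lop K f x - f x = ∫ z : ℝ, K z * (f (x - z) - f x) := by
    have h1 : Integrable fun z => K z * f (x - z) :=
      hK.mul_bdd (hf.comp (measurable_const.sub measurable_id)).aestronglyMeasurable
        (ae_of_all _ fun z => hC _)
    simp only [mul_sub]
    rw [integral_sub h1 (hK.mul_const _), integral_mul_const, hKone, one_mul,
      Lop_eq_integral_translate]
  simp only [hpt]
  rw [interval_integral_swap_of_bounded hK (C := C + C)
    (by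
      unfold Function.uncurry
      exact (hf.comp (measurable_fst.sub measurable_snd)).sub (hf.comp measurable_fst))
    fun x z => (abs_sub _ _).trans (add_le_add (hC _) (hC _))]
  congr 1 with z
  congr 1
  have hi := intervalIntegrable_of_bounded hf hC
  have hshift : IntervalIntegrable (fun x => f (x - z)) volume u v :=
    intervalIntegrable_of_bounded (hf.comp (measurable_id.sub_const z)) (fun x => hC _) _ _
  rw [intervalIntegral.integral_sub hshift (hi _ _), intervalIntegral.integral_comp_sub_right,
    intervalIntegral.integral_interval_sub_interval_comm (hi _ _) (hi _ _) (hi _ _)]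

lemma abs_integral_Lop_sub_le {K : ℝ → ℝ} (hKpos : ∀ x, 0 < K x) (hK : Integrable K)
    (hKone : (∫ x : ℝ, K x) = 1) (hKmom : Integrable fun y : ℝ => K y * |y|)
    {f : ℝ → ℝ} (hf : Measurable f) {C : ℝ} (hC : ∀ x, |f x| ≤ C) (u v : ℝ) :
    |∫ x in u..v, (Lop K f x - f x)| ≤ ∫ y : ℝ, 2 * C * (K y * |y|) := by
  rw [integral_Lop_sub hK hKone hf hC, ← Real.norm_eq_abs]
  exact norm_integral_le_of_norm_le (hKmom.const_mul _)
    (ae_of_all _ fun z => abs_mul_window_sub_le (hKpos z) hC u v z)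

lemma integral_even_mul_id {K : ℝ → ℝ} (hKeven : ∀ x, K (-x) = K x) (c : ℝ) :
    (∫ z : ℝ, K z * (z * c)) = 0 := by
  have h := integral_neg_eq_self (fun z : ℝ => K z * (z * c)) volume
  simp only [hKeven, neg_mul, mul_neg, integral_neg] at h
  linarith

lemma tendsto_integral_Lop_sub {K : ℝ → ℝ} (hKeven : ∀ x, K (-x) = K x)
    (hKpos : ∀ x, 0 < K x) (hK : Integrable K) (hKone : (∫ x : ℝ, K x) = 1)
    (hKmom : Integrable fun y : ℝ => K y * |y|) {f : ℝ → ℝ} (hf : Measurable f) {C : ℝ}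
    (hC : ∀ x, |f x| ≤ C) {a b : ℝ} (ha : Tendsto f atTop (nhds a))
    (hb : Tendsto f atBot (nhds b)) (t : ℝ) :
    Tendsto (fun R : ℝ => ∫ x in (-R - t)..(R - t), (Lop K f x - f x)) atTop (nhds 0) := by
  simp only [integral_Lop_sub hK hKone hf hC]
  rw [← integral_even_mul_id hKeven (b - a)]
  refine tendsto_integral_filter_of_dominated_convergence (fun y => 2 * C * (K y * |y|))
    (.of_forall fun R => hK.aestronglyMeasurable.mul
      ((continuous_integral_window hf hC _ _).sub
        (continuous_integral_window hf hC _ _)).aestronglyMeasurable)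
    (.of_forall fun R => ae_of_all _ fun z => abs_mul_window_sub_le (hKpos z) hC _ _ z)
    (hKmom.const_mul _) (ae_of_all _ fun z => ?_)
  rw [mul_sub z]
  refine (Tendsto.sub ?_ ?_).const_mul _
  · exact tendsto_integral_window hf hC hb (fun s => tendsto_atBot_add_const_left _ _
      (tendsto_atBot_add_const_right _ (-t) tendsto_neg_atTop_atBot)) z
  · exact tendsto_integral_window hf hC ha (fun s => tendsto_atTop_add_const_left _ _
      (tendsto_atTop_add_const_right _ (-t) tendsto_id)) z

theorem weak_integral_identity (K : ℝ → ℝ)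
    (hKmeas : Measurable K) (hKeven : ∀ x : ℝ, K (-x) = K x)
    (hKpos : ∀ x : ℝ, 0 < K x)
    (hKint : Integrable K) (hKone : (∫ x : ℝ, K x) = 1)
    (hKmom : Integrable (fun y : ℝ => K y * |y|))
    (φ : ℝ → ℝ) (μ : ℝ) (hμ : 0 ≤ μ) (hφ : IsSolution K μ φ)
    (hnonneg : ∀ x : ℝ, 0 ≤ φ x)
    (hφtop : ∃ a : ℝ, Tendsto φ atTop (nhds a))
    (hφbot : ∃ b : ℝ, Tendsto φ atBot (nhds b))
    (ψ : ℝ → ℝ) (hψsmooth : ContDiff ℝ (⊤ : ℕ∞) ψ) (hψsupp : HasCompactSupport ψ)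
    (hψnonneg : ∀ x : ℝ, 0 ≤ ψ x) (hψne : ψ ≠ 0) :
    Tendsto
      (fun R : ℝ => ∫ x in (-R)..R, ∫ y : ℝ, ψ (x - y) * (φ y * ((μ - 1) - φ y)))
      atTop (nhds 0) := by
  obtain ⟨hφmeas, ⟨C, hC⟩, heq⟩ := hφ
  obtain ⟨a, ha⟩ := hφtop
  obtain ⟨b, hb⟩ := hφbot
  set g : ℝ → ℝ := fun y => φ y * ((μ - 1) - φ y) with hg
  have hgL : g = fun y => Lop K φ y - φ y := by
    ext y
    simp only [hg]
    linarith [heq y]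
  have hgmeas : Measurable g := hφmeas.mul (measurable_const.sub hφmeas)
  have hgC (y : ℝ) : |g y| ≤ C * (|μ - 1| + C) := by
    rw [hg, abs_mul]
    exact mul_le_mul (hC y) ((abs_sub _ _).trans (add_le_add le_rfl (hC y))) (abs_nonneg _)
      ((abs_nonneg _).trans (hC y))
  have hψint : Integrable ψ := hψsmooth.continuous.integrable_of_hasCompactSupport hψsupp
  have hrepr (R : ℝ) : (∫ x in (-R)..R, ∫ y : ℝ, ψ (x - y) * g y) =
      ∫ t : ℝ, ψ t * ∫ x in (-R - t)..(R - t), g x := by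
    have hconv (x : ℝ) : (∫ y : ℝ, ψ (x - y) * g y) = ∫ t : ℝ, ψ t * g (x - t) :=
      Lop_eq_integral_translate ψ g x
    simp only [hconv]
    rw [interval_integral_swap_of_bounded hψint
      (by exact hgmeas.comp (measurable_fst.sub measurable_snd)) fun x t => hgC (x - t)]
    simp only [intervalIntegral.integral_comp_sub_right]
  have hwindow (R : ℝ) : Continuous fun t : ℝ => ∫ x in (-R - t)..(R - t), g x := by
    have hi := intervalIntegrable_of_bounded hgmeas hgC
    have hsplit (t : ℝ) : (∫ x in (-R - t)..(R - t), g x) =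
        (∫ x in (-R - t)..0, g x) - ∫ x in (R - t)..0, g x := by
      rw [← intervalIntegral.integral_add_adjacent_intervals (hi (-R - t) (R - t)) (hi (R - t) 0)]
      ring
    simp only [hsplit]
    exact (continuous_integral_window hgmeas hgC _ _).sub
      (continuous_integral_window hgmeas hgC _ _)
  change Tendsto (fun R : ℝ => ∫ x in (-R)..R, ∫ y : ℝ, ψ (x - y) * g y) atTop (nhds 0)
  simp only [hrepr]
  rw [show (0 : ℝ) = ∫ t : ℝ, ψ t * 0 by simp]
  refine tendsto_integral_filter_of_dominated_convergence
    (fun t => ψ t * ∫ y : ℝ, 2 * C * (K y * |y|))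
    (.of_forall fun R => hψint.aestronglyMeasurable.mul (hwindow R).aestronglyMeasurable)
    (.of_forall fun R => ae_of_all _ fun t => ?_) (hψint.mul_const _)
    (ae_of_all _ fun t => Tendsto.const_mul _ ?_)
  · rw [Real.norm_eq_abs, abs_mul, abs_of_nonneg (hψnonneg t), hgL]
    exact mul_le_mul_of_nonneg_left
      (abs_integral_Lop_sub_le hKpos hKint hKone hKmom hφmeas hC _ _) (hψnonneg t)
  · rw [hgL]
    exact tendsto_integral_Lop_sub hKeven hKpos hKint hKone hKmom hφmeas hC ha hb t
end

section
/- Let K : ℝ → ℝ be even, strictly positive, measurable and integrable with ∫_ℝ K = 1 and ∫_ℝ K(y)|y| dy < ∞. If φ is a continuous, nonnegative solution of the steady Whitham equation with wave speed μ = 1 (relative to K) such that the limits lim_{x→±∞} φ(x) exist (as finite real numbers), then φ ≡ 0. In other words, only the vanishing solution has unit wave speed. -/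
open Real Filter MeasureTheory

lemma tendsto_intervalIntegral_comp_add {φ : ℝ → ℝ} {C a : ℝ} {l : Filter ℝ}
    (hφ : Continuous φ) (hC : ∀ x, |φ x| ≤ C) (hl : Tendsto φ l (nhds a))
    {u : ℕ → ℝ} (hu : ∀ t, Tendsto (fun n => u n + t) atTop l) (s : ℝ) :
    Tendsto (fun n => ∫ t in (0 : ℝ)..s, φ (u n + t)) atTop (nhds (s * a)) := by
  have h : Tendsto (fun n => ∫ t in (0 : ℝ)..s, φ (u n + t)) atTop
      (nhds (∫ _ in (0 : ℝ)..s, a)) := by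
    refine intervalIntegral.tendsto_integral_filter_of_dominated_convergence (fun _ => C)
      (Eventually.of_forall fun n => ?_) (Eventually.of_forall fun n => ?_)
      intervalIntegrable_const (Eventually.of_forall fun t _ => hl.comp (hu t))
    · exact (by fun_prop : Continuous fun t => φ (u n + t)).aestronglyMeasurable
    · exact Eventually.of_forall fun t _ => hC _
  simpa using h

lemma intervalIntegral_sub_translate {φ : ℝ → ℝ} (hφ : Continuous φ) (a b y : ℝ) :
    ∫ x in a..b, (φ x - φ (x - y)) =
      (∫ t in (0 : ℝ)..(-y), φ (a + t)) - ∫ t in (0 : ℝ)..(-y), φ (b + t) := by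
  have hi : ∀ c d, IntervalIntegrable φ volume c d := fun c d => hφ.intervalIntegrable c d
  rw [intervalIntegral.integral_sub (hi _ _)
      ((by fun_prop : Continuous fun x => φ (x - y)).intervalIntegrable _ _),
    intervalIntegral.integral_comp_sub_right,
    intervalIntegral.integral_interval_sub_interval_comm (hi _ _) (hi _ _) (hi _ _),
    intervalIntegral.integral_comp_add_left, intervalIntegral.integral_comp_add_left]
  simp [sub_eq_add_neg]

lemma abs_intervalIntegral_comp_add_le {φ : ℝ → ℝ} {C : ℝ} (hC : ∀ x, |φ x| ≤ C) (a y : ℝ) :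
    |∫ t in (0 : ℝ)..(-y), φ (a + t)| ≤ C * |y| := by
  have h := intervalIntegral.norm_integral_le_of_norm_le_const (a := 0) (b := -y)
    (f := fun t => φ (a + t)) (C := C) fun t _ => hC _
  simpa using h

lemma integral_mul_neg_id_eq_zero_of_even {K : ℝ → ℝ} (hK : ∀ x, K (-x) = K x) (c : ℝ) :
    ∫ y, K y * (-y * c) = 0 := by
  have h := integral_neg_eq_self (fun y => K y * (-y * c)) volume
  have h' : (fun y => K (-y) * (- -y * c)) = fun y => -(K y * (-y * c)) := by
    funext y
    rw [hK]
    ring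
  rw [h', integral_neg] at h
  linarith

lemma sub_Lop_eq_integral {K φ : ℝ → ℝ} {C : ℝ} (hKint : Integrable K)
    (hKone : (∫ x : ℝ, K x) = 1) (hφ : Continuous φ) (hC : ∀ x, |φ x| ≤ C) (x : ℝ) :
    φ x - Lop K φ x = ∫ y, K y * (φ x - φ (x - y)) := by
  have hL : Lop K φ x = ∫ y, K y * φ (x - y) := by
    have h := integral_sub_left_eq_self (fun y => K y * φ (x - y)) volume x
    simpa [Lop] using h
  have hi : Integrable fun y => K y * φ (x - y) :=
    hKint.mul_bdd (c := C)
      (by fun_prop : Continuous fun y => φ (x - y)).aestronglyMeasurable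
      (Eventually.of_forall fun y => hC _)
  simp_rw [mul_sub]
  rw [integral_sub (hKint.mul_const _) hi, integral_mul_const, hKone, one_mul, hL]

lemma intervalIntegral_sub_Lop {K φ : ℝ → ℝ} {C : ℝ} (hKint : Integrable K)
    (hKone : (∫ x : ℝ, K x) = 1) (hφ : Continuous φ) (hC : ∀ x, |φ x| ≤ C) (a b : ℝ) :
    ∫ x in a..b, (φ x - Lop K φ x) =
      ∫ y, K y * ((∫ t in (0 : ℝ)..(-y), φ (a + t)) - ∫ t in (0 : ℝ)..(-y), φ (b + t)) := by
  simp_rw [sub_Lop_eq_integral hKint hKone hφ hC]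
  rw [intervalIntegral_integral_swap]
  · simp_rw [intervalIntegral.integral_const_mul, intervalIntegral_sub_translate hφ]
  · have : IsFiniteMeasure (volume.restrict (Set.uIoc a b)) := ⟨by simp [Set.uIoc]⟩
    have h1 : Integrable (fun z : ℝ × ℝ => K z.2)
        ((volume.restrict (Set.uIoc a b)).prod volume) := hKint.comp_snd _
    refine h1.mul_bdd (c := C + C)
      (by fun_prop : Continuous fun z : ℝ × ℝ => φ z.1 - φ (z.1 - z.2)).aestronglyMeasurable
      (Eventually.of_forall fun z => ?_)
    exact (norm_sub_le _ _).trans (add_le_add (hC _) (hC _))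

lemma tendsto_intervalIntegral_sub_Lop {K φ : ℝ → ℝ} {C a b : ℝ}
    (hKeven : ∀ x : ℝ, K (-x) = K x) (hKint : Integrable K) (hKone : (∫ x : ℝ, K x) = 1)
    (hKmom : Integrable (fun y : ℝ => K y * |y|)) (hφ : Continuous φ) (hC : ∀ x, |φ x| ≤ C)
    (ha : Tendsto φ atTop (nhds a)) (hb : Tendsto φ atBot (nhds b)) :
    Tendsto (fun n : ℕ => ∫ x in (-(n : ℝ))..n, (φ x - Lop K φ x)) atTop (nhds 0) := by
  simp_rw [intervalIntegral_sub_Lop hKint hKone hφ hC]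
  refine (congrArg (fun c => Tendsto _ atTop (nhds c))
    (integral_mul_neg_id_eq_zero_of_even hKeven (b - a))).mp ?_
  have hprim : ∀ c : ℝ, Continuous fun y : ℝ => ∫ t in (0 : ℝ)..(-y), φ (c + t) := fun c =>
    (intervalIntegral.continuous_primitive (f := fun t => φ (c + t))
      (fun _ _ => (by fun_prop : Continuous fun t => φ (c + t)).intervalIntegrable _ _) 0).comp
      continuous_neg
  refine tendsto_integral_filter_of_dominated_convergence (fun y => ‖K y * |y|‖ * (C + C))
    (Eventually.of_forall fun n => ?_)
    (Eventually.of_forall fun n => Eventually.of_forall fun y => ?_)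
    (hKmom.norm.mul_const _) (Eventually.of_forall fun y => ?_)
  · exact hKint.aestronglyMeasurable.mul ((hprim _).sub (hprim _)).aestronglyMeasurable
  · have h := (abs_sub _ _).trans (add_le_add
      (abs_intervalIntegral_comp_add_le hC (-(n : ℝ)) y)
      (abs_intervalIntegral_comp_add_le hC (n : ℝ) y))
    rw [norm_mul, norm_mul, Real.norm_eq_abs, Real.norm_eq_abs, Real.norm_eq_abs, abs_abs]
    calc _ ≤ |K y| * (C * |y| + C * |y|) := mul_le_mul_of_nonneg_left h (abs_nonneg _)
      _ = _ := by ring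
  · refine Tendsto.const_mul _ ?_
    rw [mul_sub]
    refine (tendsto_intervalIntegral_comp_add hφ hC hb (fun t => ?_) _).sub
      (tendsto_intervalIntegral_comp_add hφ hC ha (fun t => ?_) _)
    · exact tendsto_atBot_add_const_right _ _
        (tendsto_neg_atTop_atBot.comp tendsto_natCast_atTop_atTop)
    · exact tendsto_atTop_add_const_right _ _ tendsto_natCast_atTop_atTop

theorem unit_speed_implies_vanishing (K : ℝ → ℝ)
    (hKmeas : Measurable K) (hKeven : ∀ x : ℝ, K (-x) = K x)
    (hKpos : ∀ x : ℝ, 0 < K x)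
    (hKint : Integrable K) (hKone : (∫ x : ℝ, K x) = 1)
    (hKmom : Integrable (fun y : ℝ => K y * |y|))
    (φ : ℝ → ℝ) (hφcont : Continuous φ) (hφ : IsSolution K 1 φ)
    (hnonneg : ∀ x : ℝ, 0 ≤ φ x)
    (hφtop : ∃ a : ℝ, Tendsto φ atTop (nhds a))
    (hφbot : ∃ b : ℝ, Tendsto φ atBot (nhds b)) :
    ∀ x : ℝ, φ x = 0 := by
  obtain ⟨a, ha⟩ := hφtop
  obtain ⟨b, hb⟩ := hφbot
  obtain ⟨-, ⟨C, hC⟩, heq⟩ := hφ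
  have hlim := tendsto_intervalIntegral_sub_Lop hKeven hKint hKone hKmom hφcont hC ha hb
  have hsq : ∀ x, φ x - Lop K φ x = φ x ^ 2 := fun x => by linarith [heq x]
  simp_rw [hsq] at hlim
  have hcont : Continuous fun x => φ x ^ 2 := hφcont.pow 2
  intro x
  by_contra hx
  have hpos : 0 < ∫ t in (x - 1)..(x + 1), φ t ^ 2 :=
    intervalIntegral.integral_pos (by linarith) hcont.continuousOn (fun t _ => sq_nonneg (φ t))
      ⟨x, ⟨by linarith, by linarith⟩, by positivity⟩
  refine hpos.not_ge (ge_of_tendsto hlim ?_)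
  obtain ⟨N, hN⟩ := exists_nat_ge (|x| + 1)
  filter_upwards [eventually_ge_atTop N] with n hn
  have hn' : (N : ℝ) ≤ n := by exact_mod_cast hn
  exact intervalIntegral.integral_mono_interval (by linarith [neg_abs_le x]) (by linarith)
    (by linarith [le_abs_self x]) (Eventually.of_forall fun t => sq_nonneg (φ t))
    (hcont.intervalIntegrable _ _)
end

section
/- Let K : ℝ → ℝ be measurable, nonnegative and integrable. If φ is a solution of the steady Whitham equation with wave speed μ (relative to K) satisfying φ(x) ≤ μ/2 for all x ∈ ℝ, then for all x, y ∈ ℝ one has (φ(x) − φ(y))² ≤ |Lφ(x) − Lφ(y)|. -/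
open Real Filter MeasureTheory

theorem quadratic_difference_bound (K : ℝ → ℝ)
    (hKmeas : Measurable K) (hKnonneg : ∀ x : ℝ, 0 ≤ K x)
    (hKint : Integrable K)
    (φ : ℝ → ℝ) (μ : ℝ) (hφ : IsSolution K μ φ)
    (hb : ∀ x : ℝ, φ x ≤ μ / 2) :
    ∀ x y : ℝ, (φ x - φ y) ^ 2 ≤ |Lop K φ x - Lop K φ y| := by
  intro x y
  obtain ⟨-, -, h⟩ := hφ
  have factor : Lop K φ x - Lop K φ y = (φ x - φ y) * (μ - φ x - φ y) := by
    linear_combination h x - h y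
  have gap : |φ x - φ y| ≤ μ - φ x - φ y :=
    abs_le.mpr ⟨by linarith [hb y], by linarith [hb x]⟩
  rw [factor, abs_mul, ← sq_abs, sq]
  exact mul_le_mul_of_nonneg_left (gap.trans (le_abs_self _)) (abs_nonneg _)
end
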